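/- arXiv:1709.05911 — 6 statements merged into one kernel-verified Lean document; each statement's English description precedes it below -/
import Mathlib

section
/- Every permutation of the three-element set {ργ, σ, σρ} of generators of G = D₈ ∗ C₄ extends to an automorphism of G; that is, for each permutation π of {ργ, σ, σρ} there exists a group automorphism φ of G with φ(ργ) = π(ργ), φ(σ) = π(σ), and φ(σρ) = π(σρ). -/
/-!
Let `D8 = ⟨σ, ρ⟩` be the dihedral group of order 8 (`ρ` of order 4, `σ` of order 2,
`σρσ⁻¹ = ρ⁻¹`) and `C4 = ⟨γ⟩` the cyclic group of order 4.  The central product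
`G = D8 ∗ C4` is the quotient of `D8 × C4` by the central subgroup generated by `ρ²γ⁻²`.
We model `D8` as `DihedralGroup 4` (with `ρ = r 1`, `σ = sr 0`) and `C4` as
`Multiplicative (ZMod 4)`.
-/

open DihedralGroup

abbrev D8 : Type := DihedralGroup 4
abbrev C4 : Type := Multiplicative (ZMod 4)

/-- The central element `(ρ², γ⁻²) = (ρ², γ²)` of `D8 × C4`. -/
def zEl : D8 × C4 := (r 2, Multiplicative.ofAdd (2 : ZMod 4))

/-- The central subgroup `⟨ρ²γ⁻²⟩` of `D8 × C4`. -/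
def Zc : Subgroup (D8 × C4) := Subgroup.zpowers zEl

instance : Zc.Normal := by
  have hz : ∀ g : D8 × C4, g * zEl = zEl * g := by decide
  constructor
  intro n hn g
  obtain ⟨k, hk⟩ := Subgroup.mem_zpowers_iff.mp hn
  have hcomm : Commute g n := by
    rw [← hk]
    exact Commute.zpow_right (hz g) k
  have h : g * n * g⁻¹ = n := by rw [hcomm.eq, mul_inv_cancel_right]
  rw [h]
  exact hn

/-- The central product `G = D8 ∗ C4 = (D8 × C4) / ⟨ρ²γ⁻²⟩`. -/
abbrev GG : Type := (D8 × C4) ⧸ Zc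

/-- The image of `σ` in `G`. -/
def σ' : GG := QuotientGroup.mk (sr 0, 1)

/-- The image of `ρ` in `G`. -/
def ρ' : GG := QuotientGroup.mk (r 1, 1)

/-- The image of `γ` in `G`. -/
def γ' : GG := QuotientGroup.mk (1, Multiplicative.ofAdd (1 : ZMod 4))

/-- The generating set `{ργ, σ, σρ}` of `G`, as a triple. -/
def gens : Fin 3 → GG := ![ρ' * γ', σ', σ' * ρ']

/-- Three involutions `u 0, u 1, u 2` whose pairwise commutators all equal the same central
element `w` of exponent two. -/
structure IsPauliTriple {H : Type*} [Group H] (w : H) (u : Fin 3 → H) : Prop where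
  sq : ∀ i, u i * u i = 1
  swap : ∀ i j, i ≠ j → u i * u j = w * (u j * u i)
  sq_center : w * w = 1
  comm : ∀ i, u i * w = w * u i

theorem IsPauliTriple.comp_perm {H : Type*} [Group H] {w : H} {u : Fin 3 → H}
    (h : IsPauliTriple w u) (π : Equiv.Perm (Fin 3)) : IsPauliTriple w (u ∘ π) where
  sq i := h.sq (π i)
  swap i j hij := h.swap (π i) (π j) (π.injective.ne hij)
  sq_center := h.sq_center
  comm i := h.comm (π i)

theorem pow_zmod_val_add {H : Type*} [Group H] {n : ℕ} [NeZero n] {t : H} (ht : t ^ n = 1)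
    (i j : ZMod n) : t ^ (i + j).val = t ^ i.val * t ^ j.val := by
  rw [ZMod.val_add, ← pow_add, ← pow_eq_pow_mod _ ht]

theorem pow_zmod_val_sub {H : Type*} [Group H] {n : ℕ} [NeZero n] {t : H} (ht : t ^ n = 1)
    (i j : ZMod n) : t ^ (j - i).val = (t ^ i.val)⁻¹ * t ^ j.val := by
  rw [eq_inv_mul_iff_mul_eq, ← pow_zmod_val_add ht, add_sub_cancel]

/-- The homomorphism from a cyclic group sending the generator to `t`. -/
def zmodLift {H : Type*} [Group H] (n : ℕ) [NeZero n] (t : H) (ht : t ^ n = 1) :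
    Multiplicative (ZMod n) →* H where
  toFun k := t ^ k.toAdd.val
  map_one' := by simp
  map_mul' k l := pow_zmod_val_add ht k.toAdd l.toAdd

/-- The homomorphism from a dihedral group sending `r 1` to `t` and `sr 0` to `s`. -/
def dihedralLift {H : Type*} [Group H] (n : ℕ) [NeZero n] (s t : H) (hs : s * s = 1)
    (ht : t ^ n = 1) (hst : s * t * s = t⁻¹) : DihedralGroup n →* H where
  toFun
    | r i => t ^ i.val
    | sr i => s * t ^ i.val
  map_one' := by
    change t ^ (0 : ZMod n).val = 1
    simp
  map_mul' a b := by
    have hs' : s⁻¹ = s := inv_eq_of_mul_eq_one_left hs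
    have conj (k : ℕ) : s * t ^ k * s = (t ^ k)⁻¹ := by
      rw [← inv_pow, ← hst]
      nth_rw 2 4 [← hs']
      exact conj_pow.symm
    have move (k : ℕ) : t ^ k * s = s * (t ^ k)⁻¹ := by
      rw [← conj, ← mul_assoc, ← mul_assoc, hs, one_mul]
    rcases a with i | i <;> rcases b with j | j
    · exact pow_zmod_val_add ht i j
    · change s * t ^ (j - i).val = t ^ i.val * (s * t ^ j.val)
      rw [pow_zmod_val_sub ht, ← mul_assoc, ← mul_assoc, move]
    · change s * t ^ (i + j).val = s * t ^ i.val * t ^ j.val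
      rw [pow_zmod_val_add ht, mul_assoc]
    · change t ^ (j - i).val = s * t ^ i.val * (s * t ^ j.val)
      rw [pow_zmod_val_sub ht, ← mul_assoc, conj]

/-- `D8 ∗ C4` is the universal group generated by a Pauli triple. -/
theorem IsPauliTriple.exists_hom {H : Type*} [Group H] {w : H} {u : Fin 3 → H}
    (h : IsPauliTriple w u) : ∃ f : GG →* H, ∀ i, f (gens i) = u i := by
  obtain ⟨x, hx⟩ : ∃ x, u 0 = x := ⟨_, rfl⟩
  obtain ⟨y, hy⟩ : ∃ y, u 1 = y := ⟨_, rfl⟩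
  obtain ⟨z, hz⟩ : ∃ z, u 2 = z := ⟨_, rfl⟩
  have xx : x * x = 1 := hx ▸ h.sq 0
  have yy : y * y = 1 := hy ▸ h.sq 1
  have zz : z * z = 1 := hz ▸ h.sq 2
  have ww : w * w = 1 := h.sq_center
  have xw : x * w = w * x := hx ▸ h.comm 0
  have yw : y * w = w * y := hy ▸ h.comm 1
  have zw : z * w = w * z := hz ▸ h.comm 2
  have yx : y * x = w * (x * y) := hx ▸ hy ▸ h.swap 1 0 (by decide)
  have zx : z * x = w * (x * z) := hx ▸ hz ▸ h.swap 2 0 (by decide)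
  have zy : z * y = w * (y * z) := hy ▸ hz ▸ h.swap 2 1 (by decide)
  have reassoc {a b c : H} (e : a * b = c) (k : H) : a * (b * k) = c * k := by
    rw [← mul_assoc, e]
  have xx' := reassoc xx
  have yy' := reassoc yy
  have zz' := reassoc zz
  have ww' := reassoc ww
  have xw' := reassoc xw
  have yw' := reassoc yw
  have zw' := reassoc zw
  have yx' := reassoc yx
  have zx' := reassoc zx
  have zy' := reassoc zy
  clear reassoc
  have ht2 : y * z * (y * z) = w := by
    simp only [mul_assoc, *, mul_one]
  have hc2 : z * y * x * (z * y * x) = w := by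
    simp only [mul_assoc, *, mul_one, one_mul]
  have ht : (y * z) ^ 4 = 1 := by rw [pow_mul (y * z) 2 2, pow_two, pow_two, ht2, ww]
  have hc : (z * y * x) ^ 4 = 1 := by rw [pow_mul (z * y * x) 2 2, pow_two, pow_two, hc2, ww]
  have hst : y * (y * z) * y = (y * z)⁻¹ := by
    rw [eq_inv_iff_mul_eq_one]
    simp only [mul_assoc, *, one_mul]
  have hcy : Commute y (z * y * x) := by
    unfold Commute SemiconjBy
    simp only [mul_assoc, *, one_mul]
  have hct : Commute (y * z) (z * y * x) := by
    unfold Commute SemiconjBy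
    simp only [mul_assoc, *, mul_one, one_mul]
  let F : D8 × C4 →* H :=
    MonoidHom.noncommCoprod (dihedralLift 4 y (y * z) yy ht hst) (zmodLift 4 (z * y * x) hc) (by
      rintro (i | i) k
      · exact (hct.pow_left _).pow_right _
      · exact (hcy.mul_left (hct.pow_left _)).pow_right _)
  have hF : Zc ≤ F.ker := by
    rw [Zc, Subgroup.zpowers_le, MonoidHom.mem_ker]
    change (y * z) ^ 2 * (z * y * x) ^ 2 = 1
    rw [pow_two, pow_two, ht2, hc2, ww]
  refine ⟨QuotientGroup.lift Zc F hF, fun i => ?_⟩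
  fin_cases i
  · change (y * z) ^ 1 * (z * y * x) ^ 1 = u 0
    rw [hx, pow_one, pow_one]
    simp only [mul_assoc, *, mul_one, one_mul]
  · change y * (y * z) ^ 0 * (z * y * x) ^ 0 = u 1
    rw [hy, pow_zero, pow_zero, mul_one, mul_one]
  · change y * (y * z) ^ 1 * (z * y * x) ^ 0 = u 2
    rw [hz, pow_zero, pow_one, mul_one, yy', one_mul]

theorem isPauliTriple_gens : IsPauliTriple (ρ' * ρ') gens where
  sq i := by
    fin_cases i
    · exact (QuotientGroup.eq_one_iff _).mpr (Subgroup.mem_zpowers zEl)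
    all_goals rfl
  swap i j hij := by
    fin_cases i <;> fin_cases j <;> first | exact absurd rfl hij | rfl
  sq_center := rfl
  comm i := by fin_cases i <;> rfl

theorem closure_range_gens : Subgroup.closure (Set.range gens) = ⊤ := by
  have mem (i : Fin 3) : gens i ∈ Subgroup.closure (Set.range gens) :=
    Subgroup.subset_closure ⟨i, rfl⟩
  have hσ : σ' ∈ Subgroup.closure (Set.range gens) := mem 1
  have hρ : ρ' ∈ Subgroup.closure (Set.range gens) :=
    (Subgroup.mul_mem_cancel_left _ hσ).mp (mem 2)
  have hγ : γ' ∈ Subgroup.closure (Set.range gens) :=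
    (Subgroup.mul_mem_cancel_left _ hρ).mp (mem 0)
  rw [eq_top_iff]
  rintro g -
  obtain ⟨⟨d, k⟩, rfl⟩ := QuotientGroup.mk_surjective g
  rcases d with i | i
  · have e : ((r i, k) : D8 × C4) = (r 1, 1) ^ i.val * (1, Multiplicative.ofAdd 1) ^ k.toAdd.val := by
      revert i k
      decide
    rw [e]
    exact mul_mem (pow_mem hρ _) (pow_mem hγ _)
  · have e : ((sr i, k) : D8 × C4) =
        (sr 0, 1) * (r 1, 1) ^ i.val * (1, Multiplicative.ofAdd 1) ^ k.toAdd.val := by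
      revert i k
      decide
    rw [e]
    exact mul_mem (mul_mem hσ (pow_mem hρ _)) (pow_mem hγ _)

theorem eq_id_of_map_gens {f : GG →* GG} (hf : ∀ i, f (gens i) = gens i) :
    f = MonoidHom.id GG :=
  MonoidHom.eq_of_eqOn_dense closure_range_gens (by rintro _ ⟨i, rfl⟩; exact hf i)

/-- Every permutation of the three generators `ργ, σ, σρ` of `G = D₈ ∗ C₄` extends to an
automorphism of `G`. -/
theorem every_perm_of_generators_extends_to_aut (π : Equiv.Perm (Fin 3)) :
    ∃ φ : GG ≃* GG, ∀ i : Fin 3, φ (gens i) = gens (π i) := by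
  obtain ⟨f, hf⟩ := (isPauliTriple_gens.comp_perm π).exists_hom
  obtain ⟨g, hg⟩ := (isPauliTriple_gens.comp_perm π⁻¹).exists_hom
  refine ⟨f.toMulEquiv g (eq_id_of_map_gens fun i => ?_) (eq_id_of_map_gens fun i => ?_), hf⟩
  · simp [hf, hg]
  · simp [hf, hg]
end

section
/- There exists a group automorphism of G = D₈ ∗ C₄ that cyclically permutes the elements ργ, σ, σρ (sending ργ ↦ σ ↦ σρ ↦ ργ) and fixes γ; consequently this automorphism permutes the subgroups A₁, A₂, A₃ cyclically (sending A₁ onto A₂, A₂ onto A₃, and A₃ onto A₁). -/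
/-!
Let `D8 = ⟨σ, ρ⟩` be the dihedral group of order 8 (`ρ` of order 4, `σ` of order 2,
`σρσ⁻¹ = ρ⁻¹`) and `C4 = ⟨γ⟩` the cyclic group of order 4.  The central product
`G = D8 ∗ C4` is the quotient of `D8 × C4` by the central subgroup generated by `ρ²γ⁻²`.
We model `D8` as `DihedralGroup 4` (with `ρ = r 1`, `σ = sr 0`) and `C4` as
`Multiplicative (ZMod 4)`.
-/

open DihedralGroup

/-- The maximal abelian subgroup `A₁ = ⟨γ, ργ⟩` of `G`. -/
def A₁ : Subgroup GG := Subgroup.closure {γ', ρ' * γ'}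

/-- The maximal abelian subgroup `A₂ = ⟨γ, σ⟩` of `G`. -/
def A₂ : Subgroup GG := Subgroup.closure {γ', σ'}

/-- The maximal abelian subgroup `A₃ = ⟨γ, σρ⟩` of `G`. -/
def A₃ : Subgroup GG := Subgroup.closure {γ', σ' * ρ'}

theorem mk_eq_mk_of_inv_mul {x y : D8 × C4} (h : x⁻¹ * y = 1 ∨ x⁻¹ * y = zEl) :
    (x : GG) = (y : GG) := by
  rw [QuotientGroup.eq]
  rcases h with h | h <;> rw [h]
  · exact Zc.one_mem
  · exact Subgroup.mem_zpowers zEl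

/-- A representative in `D8 × C4` of the image under the cyclic automorphism, which sends
`ρ ↦ σγ⁻¹`, `σ ↦ σρ` and `γ ↦ γ`. -/
def cyclicRep : D8 × C4 → D8 × C4
  | (r i, c) => (sr 0 ^ i.val, c * Multiplicative.ofAdd (-i))
  | (sr i, c) => (sr 1 * sr 0 ^ i.val, c * Multiplicative.ofAdd (-i))

/-- The homomorphism `D8 × C4 → G` underlying the cyclic automorphism. -/
def cyclicLift : D8 × C4 →* GG :=
  MonoidHom.mk' (fun x => (cyclicRep x : GG)) fun x y => by
    have h : ∀ x y : D8 × C4, (cyclicRep (x * y))⁻¹ * (cyclicRep x * cyclicRep y) = 1 ∨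
        (cyclicRep (x * y))⁻¹ * (cyclicRep x * cyclicRep y) = zEl := by
      decide +kernel
    exact mk_eq_mk_of_inv_mul (h x y)

/-- The endomorphism of `G` sending `ρ ↦ σγ⁻¹`, `σ ↦ σρ` and `γ ↦ γ`. -/
def cyclicHom : GG →* GG :=
  QuotientGroup.lift Zc cyclicLift <|
    Subgroup.zpowers_le.mpr (mk_eq_mk_of_inv_mul (y := 1) (by decide))

theorem cyclicHom_cube (g : GG) : cyclicHom (cyclicHom (cyclicHom g)) = g := by
  induction g using QuotientGroup.induction_on with
  | H x =>
    have h : ∀ x : D8 × C4, (cyclicRep (cyclicRep (cyclicRep x)))⁻¹ * x = 1 ∨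
        (cyclicRep (cyclicRep (cyclicRep x)))⁻¹ * x = zEl := by
      decide +kernel
    exact mk_eq_mk_of_inv_mul (h x)

/-- The automorphism of `G` of order 3 sending `ρ ↦ σγ⁻¹`, `σ ↦ σρ` and `γ ↦ γ`. -/
def cyclicAut : GG ≃* GG where
  toFun := cyclicHom
  invFun g := cyclicHom (cyclicHom g)
  left_inv := cyclicHom_cube
  right_inv := cyclicHom_cube
  map_mul' := cyclicHom.map_mul

/-- There is an automorphism of `G = D₈ ∗ C₄` cyclically permuting `ργ ↦ σ ↦ σρ ↦ ργ` and
fixing `γ`; it permutes the subgroups `A₁, A₂, A₃` cyclically. -/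
theorem exists_cyclic_aut :
    ∃ φ : GG ≃* GG,
      φ (ρ' * γ') = σ' ∧ φ σ' = σ' * ρ' ∧ φ (σ' * ρ') = ρ' * γ' ∧ φ γ' = γ' ∧
      A₁.map φ.toMonoidHom = A₂ ∧ A₂.map φ.toMonoidHom = A₃ ∧ A₃.map φ.toMonoidHom = A₁ := by
  have hργ : cyclicAut (ρ' * γ') = σ' :=
    mk_eq_mk_of_inv_mul (x := cyclicRep ((r 1, 1) * (1, Multiplicative.ofAdd 1))) (by decide)
  have hσ : cyclicAut σ' = σ' * ρ' :=
    mk_eq_mk_of_inv_mul (x := cyclicRep (sr 0, 1)) (y := (sr 0, 1) * (r 1, 1)) (by decide)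
  have hσρ : cyclicAut (σ' * ρ') = ρ' * γ' :=
    mk_eq_mk_of_inv_mul (x := cyclicRep ((sr 0, 1) * (r 1, 1)))
      (y := (r 1, 1) * (1, Multiplicative.ofAdd 1)) (by decide)
  have hγ : cyclicAut γ' = γ' :=
    mk_eq_mk_of_inv_mul (x := cyclicRep (1, Multiplicative.ofAdd 1)) (by decide)
  have map_closure (a b : GG) (hab : cyclicAut a = b) :
      (Subgroup.closure {γ', a}).map cyclicAut.toMonoidHom = Subgroup.closure {γ', b} := by
    rw [MonoidHom.map_closure, Set.image_pair]
    exact congrArg₂ (fun x y => Subgroup.closure {x, y}) hγ hab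
  exact ⟨cyclicAut, hργ, hσ, hσρ, hγ, map_closure _ _ hργ, map_closure _ _ hσ,
    map_closure _ _ hσρ⟩
end

section
/- The dimensions hⁱ = dim_{𝔽₂} Hⁱ(G; 𝔽₂) of the mod-2 group cohomology of G = D₈ ∗ C₄ in degrees 0 through 4 are h⁰ = 1, h¹ = 3, h² = 5, h³ = 6, h⁴ = 7. -/
/-!
Let `D8 = ⟨σ, ρ⟩` be the dihedral group of order 8 (`ρ` of order 4, `σ` of order 2,
`σρσ⁻¹ = ρ⁻¹`) and `C4 = ⟨γ⟩` the cyclic group of order 4.  The central product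
`G = D8 ∗ C4` is the quotient of `D8 × C4` by the central subgroup generated by `ρ²γ⁻²`.
We model `D8` as `DihedralGroup 4` (with `ρ = r 1`, `σ = sr 0`) and `C4` as
`Multiplicative (ZMod 4)`.
-/

open DihedralGroup

open CategoryTheory groupCohomology

section Coregular

variable (k : Type) [Field k] (G : Type) [Group G]

/-- The representation of `G` on functions `α × G → k` by right translation of the second
variable: a product of copies of the coregular representation. -/
def coregularRho (α : Type) : Representation k G (α × G → k) where
  toFun x := LinearMap.funLeft k k fun p => (p.1, p.2 * x)
  map_one' := by ext; simp [LinearMap.funLeft_apply]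
  map_mul' x y := by
    refine LinearMap.ext fun f => funext fun p => ?_
    simp [LinearMap.funLeft_apply, mul_assoc]

/-- `coregularRho` as an object of `Rep k G`. -/
abbrev coregular (α : Type) : Rep k G := Rep.of (coregularRho k G α)

variable {k G}

@[simp]
lemma coregularRho_apply {α : Type} (x : G) (f : α × G → k) (p : α × G) :
    coregularRho k G α x f p = f (p.1, p.2 * x) := rfl

lemma mem_invariants_coregularRho {α : Type} {f : α × G → k} :
    f ∈ (coregularRho k G α).invariants ↔ ∃ c : α → k, f = fun p => c p.1 := by
  constructor
  · intro h
    refine ⟨fun i => f (i, 1), funext fun p => ?_⟩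
    simpa using congrFun (h p.2) (p.1, 1)
  · rintro ⟨c, rfl⟩ x
    rfl

/-- Functions on `α × G` are coinduced from the trivial subgroup. -/
def coregularIsoCoind (α : Type) :
    coregular k G α ≅
      Rep.coind (⊥ : Subgroup G).subtype (Rep.trivial k (⊥ : Subgroup G) (α → k)) where
  hom := Rep.ofHom
    { toLinearMap :=
        { toFun f := ⟨fun x i => f (i, x), fun g h => by
            obtain rfl := Subsingleton.elim g 1
            simp⟩
          map_add' _ _ := rfl
          map_smul' _ _ := rfl }
      isIntertwining' _ := rfl }
  inv := Rep.ofHom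
    { toLinearMap :=
        { toFun f p := f.1 p.2 p.1
          map_add' _ _ := rfl
          map_smul' _ _ := rfl }
      isIntertwining' _ := rfl }
  hom_inv_id := rfl
  inv_hom_id := rfl

lemma isZero_groupCohomology_coregular (α : Type) (n : ℕ) :
    Limits.IsZero (groupCohomology (coregular k G α) (n + 1)) :=
  (isZero_groupCohomology_succ_of_subsingleton _ n).of_iso <|
    (functor k G (n + 1)).mapIso (coregularIsoCoind α) ≪≫ coindIso _ (n + 1)

/-- The image of a morphism of representations. -/
abbrev imageRep {A B : Rep k G} (d : A ⟶ B) : Rep k G :=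
  B.subrepresentation (LinearMap.range d.hom.toLinearMap) (by
    rintro g _ ⟨x, rfl⟩
    exact ⟨A.ρ g x, Rep.hom_comm_apply d g x⟩)

/-- The inclusion of the image. -/
abbrev imageRepι {A B : Rep k G} (d : A ⟶ B) : imageRep d ⟶ B := B.subtype _ _

/-- The corestriction of a morphism to its image. -/
def toImageRep {A B : Rep k G} (d : A ⟶ B) : A ⟶ imageRep d := Rep.ofHom
  { toLinearMap := d.hom.toLinearMap.rangeRestrict
    isIntertwining' g := LinearMap.ext fun x => Subtype.ext (Rep.hom_comm_apply d g x) }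

/-- The short complex `0 ⟶ A ⟶ B ⟶ im d ⟶ 0`. -/
abbrev imageShortComplex {A B C : Rep k G} (i : A ⟶ B) (d : B ⟶ C) (h : i ≫ d = 0) :
    ShortComplex (Rep k G) :=
  ShortComplex.mk i (toImageRep d) (by
    ext x
    exact congrArg (fun f : A ⟶ C => f.hom x) h)

lemma imageShortComplex_shortExact {A B C : Rep k G} (i : A ⟶ B) (d : B ⟶ C) (h : i ≫ d = 0)
    (hi : Function.Injective i.hom) (hex : ∀ v, d.hom v = 0 → ∃ x, i.hom x = v) :
    (imageShortComplex i d h).ShortExact where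
  exact := by
    rw [← ShortComplex.exact_map_iff_of_faithful _ (forget₂ (Rep k G) (ModuleCat k)),
      ShortComplex.moduleCat_exact_iff]
    intro v hv
    exact hex v (congrArg Subtype.val hv)
  mono_f := (Rep.mono_iff_injective _).2 hi
  epi_g := (Rep.epi_iff_surjective _).2 d.hom.toLinearMap.surjective_rangeRestrict

section DimensionShift

variable {A C : Rep k G} {α : Type} (i : A ⟶ coregular k G α) (d : coregular k G α ⟶ C)

lemma comp_eq_zero_and_shortExact (hi : Function.Injective i.hom)
    (hex : ∀ v, d.hom v = 0 ↔ ∃ x, i.hom x = v) :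
    ∃ h : i ≫ d = 0, (imageShortComplex i d h).ShortExact :=
  have h : i ≫ d = 0 := by
    ext x
    exact (hex _).2 ⟨x, rfl⟩
  ⟨h, imageShortComplex_shortExact i d h hi fun v => (hex v).1⟩

/-- Dimension shifting along an embedding into a coregular representation. -/
lemma finrank_groupCohomology_add_two (hi : Function.Injective i.hom)
    (hex : ∀ v, d.hom v = 0 ↔ ∃ x, i.hom x = v) (n : ℕ) :
    Module.finrank k (groupCohomology A (n + 2)) =
      Module.finrank k (groupCohomology (imageRep d) (n + 1)) := by
  obtain ⟨h, hS⟩ := comp_eq_zero_and_shortExact i d hi hex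
  have := isIso_δ_of_isZero hS (n + 1) (isZero_groupCohomology_coregular α n)
    (isZero_groupCohomology_coregular α (n + 1))
  exact (asIso (δ hS (n + 1) (n + 2) rfl)).toLinearEquiv.finrank_eq.symm

/-- If `d` kills the invariants, then `H¹` of the kernel of `d` is the space of invariants of the
image of `d`. -/
lemma finrank_groupCohomology_one (hi : Function.Injective i.hom)
    (hex : ∀ v, d.hom v = 0 ↔ ∃ x, i.hom x = v)
    (hinv : ∀ v ∈ (coregularRho k G α).invariants, d.hom v = 0) :
    Module.finrank k (groupCohomology A 1) =
      Module.finrank k (imageRep d).ρ.invariants := by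
  obtain ⟨h, hS⟩ := comp_eq_zero_and_shortExact i d hi hex
  have hepi := epi_δ_of_isZero hS 0 (isZero_groupCohomology_coregular α 0)
  have hz : (mapShortComplex₃ hS (rfl : 0 + 1 = 1)).f = 0 := by
    have hd : (Rep.invariantsFunctor k G).map (toImageRep d) = 0 :=
      ModuleCat.hom_ext <| LinearMap.ext fun v => Subtype.ext (Subtype.ext (hinv v.1 v.2))
    have hcomp := map_id_comp_H0Iso_hom (toImageRep d)
    rw [hd, Limits.comp_zero] at hcomp
    exact (cancel_mono (H0Iso (imageRep d)).hom).1 (hcomp.trans Limits.zero_comp.symm)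
  have hmono : Mono (δ hS 0 1 rfl) := (mapShortComplex₃_exact hS rfl).mono_g hz
  have := isIso_of_mono_of_epi (δ hS 0 1 rfl)
  exact ((asIso (δ hS 0 1 rfl)).symm ≪≫ H0Iso (imageRep d)).toLinearEquiv.finrank_eq

end DimensionShift

lemma finrank_invariants_imageRep {A : Rep k G} {α : Type} [Fintype α]
    (d : A ⟶ coregular k G α)
    (h : ∀ c : α → k, ∃ x, d.hom x = fun p => c p.1) :
    Module.finrank k (imageRep d).ρ.invariants = Fintype.card α := by
  have e : (α → k) ≃ₗ[k] (imageRep d).ρ.invariants :=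
    LinearEquiv.ofBijective
      { toFun c := ⟨⟨fun p => c p.1, h c⟩, fun g => Subtype.ext rfl⟩
        map_add' _ _ := rfl
        map_smul' _ _ := rfl }
      ⟨fun c c' hc => funext fun i =>
        congrFun (congrArg (fun v => v.1.1) hc) (i, (1 : G)), fun v => by
        obtain ⟨c, hc⟩ := mem_invariants_coregularRho.1
          (fun g => congrArg Subtype.val (v.2 g) :
            v.1.1 ∈ (coregularRho k G α).invariants)
        exact ⟨c, Subtype.ext (Subtype.ext hc.symm)⟩⟩
  rw [← e.finrank_eq, Module.finrank_fintype_fun_eq_card]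

end Coregular

section BitMatrix

/-- The `q`-th binary digit of `x`, as an element of `ZMod 2`. -/
def bit (x q : ℕ) : ZMod 2 := if x.testBit q then 1 else 0

/-- The matrix over `ZMod 2` whose `p`-th column has the binary digits of `D p` as entries. -/
def bitMatrix (M N : ℕ) (D : ℕ → ℕ) : Matrix (Fin M) (Fin N) (ZMod 2) :=
  Matrix.of fun q p => bit (D p) q

/-- The bitwise sum of the columns in a list selected by the binary digits of `x`. -/
def bitApply : List ℕ → ℕ → ℕ
  | [], _ => 0
  | d :: ds, x => (x % 2 * d) ^^^ bitApply ds (x / 2)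

lemma bit_xor (x y q : ℕ) : bit (x ^^^ y) q = bit x q + bit y q := by
  unfold bit
  rw [Nat.testBit_xor]
  cases x.testBit q <;> cases y.testBit q <;> decide

lemma bit_mod_two_mul (x d q : ℕ) : bit (x % 2 * d) q = bit d q * bit x 0 := by
  rcases Nat.mod_two_eq_zero_or_one x with h | h <;> simp [bit, Nat.testBit_zero, h]

lemma bit_bitApply (D : List ℕ) (x q : ℕ) :
    bit (bitApply D x) q = ∑ p ∈ Finset.range D.length, bit (D.getD p 0) q * bit x p := by
  induction D generalizing x with
  | nil => simp [bitApply, bit]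
  | cons d ds ih =>
    rw [bitApply, bit_xor, ih, List.length_cons, Finset.sum_range_succ', bit_mod_two_mul, add_comm]
    simp [bit, Nat.testBit_succ]

lemma bitMatrix_mul (K M : ℕ) {N : ℕ} (E : List ℕ) (hE : E.length = N) (D : ℕ → ℕ) :
    bitMatrix K N (E.getD · 0) * bitMatrix N M D = bitMatrix K M fun p => bitApply E (D p) := by
  subst hE
  ext q p
  simp only [bitMatrix, Matrix.mul_apply, Matrix.of_apply, bit_bitApply]
  rw [← Fin.sum_univ_eq_sum_range (fun j => bit (E.getD j 0) q * bit (D p) j)]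

lemma bitMatrix_add (M N : ℕ) (D E : ℕ → ℕ) :
    bitMatrix M N D + bitMatrix M N E = bitMatrix M N fun p => D p ^^^ E p := by
  ext q p
  simp [bitMatrix, bit_xor]

lemma bitMatrix_congr {M N : ℕ} {D E : ℕ → ℕ} (h : ∀ p < N, D p = E p) :
    bitMatrix M N D = bitMatrix M N E := by
  ext q p
  simp [bitMatrix, h p p.2]

lemma bitMatrix_eq_zero {M N : ℕ} {D : ℕ → ℕ} (h : ∀ p < N, D p = 0) : bitMatrix M N D = 0 := by
  ext q p
  simp [bitMatrix, bit, h p p.2]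

lemma bitMatrix_eq_one {N : ℕ} {D : ℕ → ℕ} (h : ∀ p < N, D p = 2 ^ p) : bitMatrix N N D = 1 := by
  ext q p
  simp [bitMatrix, bit, h p p.2, Nat.testBit_two_pow, Matrix.one_apply, Fin.ext_iff,
    eq_comm (a := (q : ℕ))]

/-- The indicator of the `i`-th block of sixteen binary digits. -/
def blockOnes (i : ℕ) : ℕ := 65535 <<< (16 * i)

lemma bit_blockOnes (i j g : ℕ) (hg : g < 16) :
    bit (blockOnes i) (g + 16 * j) = if i = j then 1 else 0 := by
  have h : (65535 : ℕ) = 2 ^ 16 - 1 := by norm_num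
  simp only [bit, blockOnes, Nat.testBit_shiftLeft, h, Nat.testBit_two_pow_sub_one]
  congr 1
  simp only [Bool.and_eq_true, decide_eq_true_eq, eq_iff_iff]
  omega

end BitMatrix

section Differential

/-- If `g` and `h` are the codes of `x` and `y`, then `divCode g h` is the code of `x * y⁻¹`.
The code of `γᵃ σᵇ ρᶜ` with `a < 4` and `b, c < 2` is `a + 4 * c + 8 * b`. -/
def divCode (g h : ℕ) : ℕ :=
  let c := (g / 4 + h / 4) % 2
  (g + 3 * h + 2 * c * (h / 4 + h / 8)) % 4 + 4 * c + 8 * ((g / 8 + h / 8) % 2)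

/-- Translation invariance of the `16 s × 16 r` matrix with columns `D`. -/
def IsTranslationInvariant (r s : ℕ) (D : List ℕ) : Prop :=
  ∀ i < r, ∀ g < 16, ∀ j < s, ∀ h < 16,
    (D.getD (g + 16 * i) 0).testBit (h + 16 * j) =
      (D.getD (divCode g h + 16 * i) 0).testBit (16 * j)

instance (r s : ℕ) (D : List ℕ) : Decidable (IsTranslationInvariant r s D) := by
  unfold IsTranslationInvariant
  infer_instance

variable {G : Type} (e : G ≃ Fin 16)

/-- The numbering of the standard basis of `Fin r × G → ZMod 2`. -/
def basisIndex (r : ℕ) : Fin r × G ≃ Fin (r * 16) :=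
  ((Equiv.refl _).prodCongr e).trans finProdFinEquiv

lemma basisIndex_val {r : ℕ} (p : Fin r × G) : (basisIndex e r p : ℕ) = e p.2 + 16 * p.1 := rfl

/-- The matrix with columns `D`, acting between functions on `Fin r × G` and `Fin s × G`. -/
def diffMatrix (r s : ℕ) (D : ℕ → ℕ) : Matrix (Fin s × G) (Fin r × G) (ZMod 2) :=
  (bitMatrix (s * 16) (r * 16) D).submatrix (basisIndex e s) (basisIndex e r)

lemma diffMatrix_apply {r s : ℕ} (D : ℕ → ℕ) (q : Fin s × G) (p : Fin r × G) :
    diffMatrix e r s D q p = bit (D (e p.2 + 16 * p.1)) (e q.2 + 16 * q.1) := rfl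

lemma blockOnes_mulVec {r : ℕ} (c : Fin r → ZMod 2) :
    ((bitMatrix (r * 16) r blockOnes).submatrix (basisIndex e r) id).mulVec c =
      fun p => c p.1 := by
  ext p
  simp [Matrix.mulVec, dotProduct, bitMatrix, basisIndex_val, bit_blockOnes _ _ _ (e p.2).2,
    ← Fin.ext_iff]

variable [Group G] [Fintype G]

/-- The equivariant map with matrix `diffMatrix`. -/
noncomputable def diffHom (he : ∀ x y, (e (x * y⁻¹) : ℕ) = divCode (e x) (e y)) {r s : ℕ}
    (D : List ℕ) (hD : IsTranslationInvariant r s D) :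
    coregular (ZMod 2) G (Fin r) ⟶ coregular (ZMod 2) G (Fin s) := Rep.ofHom
  { toLinearMap := (diffMatrix e r s (D.getD · 0)).mulVecLin
    isIntertwining' x := by
      have key (p : Fin r × G) (q : Fin s × G) :
          diffMatrix e r s (D.getD · 0) q p =
            bit (D.getD (e (p.2 * q.2⁻¹) + 16 * p.1) 0) (16 * q.1) := by
        rw [diffMatrix_apply, bit, bit, hD _ p.1.2 _ (e p.2).2 _ q.1.2 _ (e q.2).2, he]
      refine LinearMap.ext fun f => funext fun q => ?_
      change ∑ p, diffMatrix e r s (D.getD · 0) q p * f (p.1, p.2 * x) =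
        ∑ p, diffMatrix e r s (D.getD · 0) (q.1, q.2 * x) p * f p
      refine Fintype.sum_equiv ((Equiv.refl _).prodCongr (Equiv.mulRight x)) _ _ fun p => ?_
      rw [key, key]
      simp only [Prod.map_fst, Prod.map_snd, Equiv.prodCongr_apply, Equiv.coe_mulRight, mul_inv_rev,
        mul_assoc, mul_inv_cancel_left, Equiv.refl_apply]
      rfl }

variable (he : ∀ x y, (e (x * y⁻¹) : ℕ) = divCode (e x) (e y))

lemma diffHom_apply {r s : ℕ} (D : List ℕ) (hD : IsTranslationInvariant r s D)
    (v : Fin r × G → ZMod 2) :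
    (diffHom e he D hD).hom v = (diffMatrix e r s (D.getD · 0)).mulVec v := rfl

lemma diffHom_eq_zero_of_mem_invariants {r s : ℕ} (D : List ℕ) (hD : IsTranslationInvariant r s D)
    (hlen : D.length = r * 16) (h : ∀ i < r, bitApply D (blockOnes i) = 0)
    (v : Fin r × G → ZMod 2) (hv : v ∈ (coregularRho (ZMod 2) G (Fin r)).invariants) :
    (diffHom e he D hD).hom v = 0 := by
  obtain ⟨c, rfl⟩ := mem_invariants_coregularRho.1 hv
  rw [diffHom_apply, ← blockOnes_mulVec e, Matrix.mulVec_mulVec, diffMatrix,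
    Matrix.submatrix_mul_equiv, bitMatrix_mul _ _ _ hlen, bitMatrix_eq_zero h]
  simp

lemma exists_diffHom_eq {r s : ℕ} (D : List ℕ) (hD : IsTranslationInvariant r s D)
    (hlen : D.length = r * 16) (T : List ℕ) (hT : T.length = s * 16)
    (h : ∀ i < s, bitApply D (bitApply T (blockOnes i)) = blockOnes i) (c : Fin s → ZMod 2) :
    ∃ x, (diffHom e he D hD).hom x = fun p => c p.1 := by
  refine ⟨(((bitMatrix (r * 16) (s * 16) (T.getD · 0)).submatrix (basisIndex e r)
    (basisIndex e s)).mulVec fun p => c p.1), ?_⟩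
  rw [diffHom_apply, ← blockOnes_mulVec e, Matrix.mulVec_mulVec, Matrix.mulVec_mulVec, diffMatrix,
    Matrix.submatrix_mul_equiv, Matrix.submatrix_mul_equiv, Matrix.mul_assoc,
    bitMatrix_mul _ _ _ hT, bitMatrix_mul _ _ _ hlen, bitMatrix_congr h]

/-- A contracting homotopy `S`, `T` gives exactness at the middle of `P` and `D`. -/
lemma diffHom_eq_zero_iff {r s m : ℕ} {ι : Type} [Fintype ι] (f : ι ≃ Fin m) (P D S T : List ℕ)
    (hD : IsTranslationInvariant r s D)
    (hPlen : P.length = m) (hDlen : D.length = r * 16) (hTlen : T.length = s * 16)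
    (hDP : ∀ p < m, bitApply D (P.getD p 0) = 0)
    (hom : ∀ p < r * 16, bitApply P (S.getD p 0) ^^^ bitApply T (D.getD p 0) = 2 ^ p)
    (v : Fin r × G → ZMod 2) :
    (diffHom e he D hD).hom v = 0 ↔
      ∃ x, ((bitMatrix (r * 16) m (P.getD · 0)).submatrix (basisIndex e r) f).mulVec x = v := by
  rw [diffHom_apply, diffMatrix]
  classical
  constructor
  · intro hv
    refine ⟨((bitMatrix m (r * 16) (S.getD · 0)).submatrix f (basisIndex e r)).mulVec v, ?_⟩
    have h1 : (bitMatrix (r * 16) m (P.getD · 0)).submatrix (basisIndex e r) f *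
        (bitMatrix m (r * 16) (S.getD · 0)).submatrix f (basisIndex e r) +
        (bitMatrix (r * 16) (s * 16) (T.getD · 0)).submatrix (basisIndex e r) (basisIndex e s) *
        (bitMatrix (s * 16) (r * 16) (D.getD · 0)).submatrix (basisIndex e s) (basisIndex e r) =
        1 := by
      rw [Matrix.submatrix_mul_equiv, Matrix.submatrix_mul_equiv, bitMatrix_mul _ _ _ hPlen,
        bitMatrix_mul _ _ _ hTlen, ← Matrix.submatrix_one_equiv (basisIndex e r),
        ← bitMatrix_eq_one hom, ← bitMatrix_add]
      rfl
    have h2 := congrArg (Matrix.mulVec · v) h1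
    simpa only [Matrix.add_mulVec, ← Matrix.mulVec_mulVec, hv, Matrix.mulVec_zero, add_zero,
      Matrix.one_mulVec] using h2
  · rintro ⟨x, rfl⟩
    rw [Matrix.mulVec_mulVec, Matrix.submatrix_mul_equiv, bitMatrix_mul _ _ _ hDlen,
      bitMatrix_eq_zero hDP]
    simp

end Differential

section CentralProduct

/-- The code of an element of `D8 × C4` up to the central element `zEl`. -/
def pairCode : D8 × C4 → ℕ
  | (r i, t) => (t.toAdd.val + 2 * (i.val / 2)) % 4 + 4 * (i.val % 2)
  | (sr i, t) => (t.toAdd.val + 2 * (i.val / 2)) % 4 + 4 * (i.val % 2) + 8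

lemma pairCode_lt : ∀ a, pairCode a < 16 := by decide +kernel

lemma mem_Zc_iff {x : D8 × C4} : x ∈ Zc ↔ x = 1 ∨ x = zEl := by
  constructor
  · intro hx
    obtain ⟨n, rfl⟩ := Subgroup.mem_zpowers_iff.1 hx
    have h2 : zEl ^ (2 : ℤ) = 1 := by decide
    obtain ⟨m, rfl | rfl⟩ := Int.even_or_odd' n
    · left
      rw [zpow_mul, h2, one_zpow]
    · right
      rw [zpow_add, zpow_mul, h2, one_zpow, one_mul, zpow_one]
  · rintro (rfl | rfl)
    · exact one_mem _
    · exact Subgroup.mem_zpowers _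

lemma pairCode_eq_iff (a b : D8 × C4) : pairCode a = pairCode b ↔ a⁻¹ * b ∈ Zc := by
  rw [mem_Zc_iff]
  revert a b
  decide +kernel

lemma exists_pairCode_eq : ∀ n : Fin 16, ∃ a, pairCode a = n := by decide +kernel

lemma pairCode_mul_inv :
    ∀ a b, pairCode (a * b⁻¹) = divCode (pairCode a) (pairCode b) := by decide +kernel

/-- The numbering of the elements of `D₈ ∗ C₄`. -/
noncomputable def centralProductEquiv : GG ≃ Fin 16 :=
  Equiv.ofBijective
    (Quotient.lift (fun a => (⟨pairCode a, pairCode_lt a⟩ : Fin 16)) fun a b h =>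
      Fin.ext ((pairCode_eq_iff a b).2 (QuotientGroup.leftRel_apply.1 h)))
    ⟨by
      rintro ⟨a⟩ ⟨b⟩ h
      exact QuotientGroup.eq.2 ((pairCode_eq_iff a b).1 (congrArg Fin.val h)), fun n => by
      obtain ⟨a, ha⟩ := exists_pairCode_eq n
      exact ⟨QuotientGroup.mk a, Fin.ext ha⟩⟩

lemma centralProductEquiv_mul_inv (x y : GG) :
    (centralProductEquiv (x * y⁻¹) : ℕ) =
      divCode (centralProductEquiv x) (centralProductEquiv y) := by
  obtain ⟨a, rfl⟩ := QuotientGroup.mk_surjective x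
  obtain ⟨b, rfl⟩ := QuotientGroup.mk_surjective y
  exact pairCode_mul_inv a b

end CentralProduct

section Data

/-- The columns of the differential from degree `0` to degree `1`. -/
def diffCols0 : List ℕ :=
  [35459787399169, 70919573815298, 140808355479556, 17729893699592, 8800530597904,
   1108119388448, 2216238776896, 4432477553792, 18142084465024, 35253109391888, 70506218783776,
   141012437567552, 4408784064514, 8813541597188, 1134408777736, 2204392062977]

/-- The columns of the differential from degree `1` to degree `2`. -/
def diffCols1 : List ℕ :=
  [2310381828109828096, 4620763591795146752, 9241527183590293504, 1188967911260684288,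
   577595998194368512, 74310562101592064, 144398999552524288, 288797999105048576,
   4647724161320353792, 9227876804747853824, 1161931040393003008, 2323862080786006016,
   72761290338205696, 145258697885745152, 290517395771490304, 576812602466828288,
   302821750819569115611137, 605643501639138231222274, 77919047125678820429828,
   151410875409784557805576, 4869940445354926276880, 9463179713111534862880,
   18926359426223069725760, 37852718852446139451520, 604758057713112415469840,
   76148159536479187501600, 152296319072958375003200, 304592638145916750006400,
   9518519942059898441732, 19037039884119796883464, 37797378607069525983233,
   4759259971029949251586, 340013269070376510423040, 609189960033797773721600,
   85011964178880696156160, 170006634535188263075840, 609195076122973525245952,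
   85003821670752275922944, 170007643341504550862848, 340015286683009101725696,
   442760138366944018432, 608747339509167816704, 1217494679014309101568, 2434989358028618203136,
   2435006809476650106880, 442727487268597268480, 608753813431551262720, 1217503404738450882560]

/-- The columns of the differential from degree `2` to degree `3`. -/
def diffCols2 : List ℕ :=
  [151134174195902897463304, 302268348391805794926593, 604536696783611574124546,
   75705437678504270368772, 38074079768136648820864, 5312662293228367773968,
   10625324586456735547936, 21250649172913471095872, 7083549724304744646784,
   9739880870919181173008, 19479761741838362346016, 38959523483676724692032,
   75594757214061809795074, 151189514428123619528708, 302379028856246987399176,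
   604481356551388330541057, 628641426199609374165434368, 1239148965104999310710276096,
   2478297930209998621420552192, 314320713099804719294971904, 10058262819193749986646949888,
   19826383441679988971364417536, 39652766883359977942728835072, 5029131409596875508719550464,
   2478297930209990916249223168, 314320713099805801626730496, 628641426199611603253460992,
   1239148965105003704461819904, 39652766883359854659987570688, 5029131409596892826027687936,
   10058262819193785652055375872, 19826383441680059271389118464, 29710872619181392657215651840,
   59421745238362785314431303680, 44565954751646865420063866880, 14855436309592807390933155840,
   2785520928796386925656145920, 928766710272597820440576000, 1857533420545195640881152000,
   3713933455840679997808312320, 174085650138520471920967680, 58029103569529941912453120,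
   116058207139059883824906240, 232116137572736537355878400, 7254220162403132453683200,
   14508440324806264907366400, 10882716654231986550865920, 3627118728112850778193920,
   638624513700337743843819520, 1277249027400411604896972800, 2553364669551111925839953920,
   464383355203924372886650880, 9908511858033373400830836736, 19817023716066746801661673472,
   39615913544839274165702754304, 4954291347305740178038980608, 19809458812251773679117008896,
   39618917624503547358234017792, 4961432891884278222520582144, 9904731619768952681909977088,
   348171300141933126819512320, 696342600283866189214515200, 1392684923862349148135096320,
   2495223223731054578845614080, 19961797300792378324351451136, 39633452404877245646773420032,
   4990502452631674799599386624, 9980934068685242639925116928, 312129538510516584267644928,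
   624259077021033168283631616, 1248518154042066336567263232, 2477769035540201951559942144,
   9922863182737952912055533568, 19845726365475905824095338496, 39691452730951811648190676992,
   5106502828075423572139966464, 2480716667306445403438841856, 319158187292714776005967872,
   620182487291210114391343104, 1240360547296288544078757888]

/-- The columns of the differential from degree `3` to degree `4`. -/
def diffCols3 : List ℕ :=
  [10058262821500683642675929096, 19826383446293856283422375937, 39652766892583490442194092034,
   5029131410750341821337964548, 2478297930804464958960568448, 314320713207889976480497936,
   628641426348225958550438432, 1239148965402232479480284224, 10058262819517973906726062208,
   19826383442260882817112080656, 39652766883440901723655242272, 5029131409758986953363031104,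
   2478297934822238776528502786, 314320722324301522185228292, 628641427354780475267751944,
   1239148967411119388264251393, 29710867896670513124517871616, 59421735793341026249035743232,
   44565935861603347289272745984, 14855469366083878084598038528, 2785445368622314402491662336,
   928615589924452774111608832, 1857231179848905548223217664, 3714462359697811096446435328,
   174085631619155854220066816, 58029066530800706510651392, 116058133061601413021302784,
   232116266123202826042605568, 7253923852569249239269376, 14507847705138498478538752,
   10881531414896453693210624, 3629175535573469765828608, 5172014448931175958108782460928000,
   5172014448931175958110951419412480, 5172014448931175958115353760890880,
   5172014448931175958107665769431040, 5172014448931175958142283205836800,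
   5172014448931175958176986541588480, 5172014448931175958247424005242880,
   5172014448931175958124416141885440, 20203181441137406095158390292480,
   20203181441137406087470398832640, 20203181441137406088587090329600,
   20203181441137406090756048814080, 20203181441137406227228634644480,
   20203181441137406104220771287040, 20203181441137406122087835238400,
   20203181441137406156791170990080, 3095492341496325616448307200, 1547505332219343442242764800,
   3095010663357822973916610560, 1547746179395206034170839040, 49518215483957913640717254656,
   24758895242837105575919091712, 49517790467299508179492143104, 24759107741978956820358627328,
   12089996085050363313913856, 6045828174719152319168512, 12091656277661154784968704,
   6044998042525181656956928, 193430639913830580978974720, 96714379200411360050544640,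
   193428758333268725690531840, 96715319959026385027072000, 323276631720314440681175927226368,
   323302360382430383980692537081856, 323279540170937187652392307392512,
   323303226728017337438964583235584, 4868983178381538429365286852362240,
   4868999611314797996538786972958720, 4869027853040332657672394626826240,
   4869014412221996618206049908817920, 4869007061310993033641667791421440,
   4868973117772146121766883316203520, 4868979218087979520793616255549440,
   4868987048452809560380520550891520, 323261489631123994598869752086528,
   323272076204049491816080186802176, 323293231215719197047388689661952,
   323256350482703248966546635096064, 3353733404657291233807273669165056,
   1838500082000467600803239445921792, 3353749242808572708827779593928704,
   1838531758303013189467752206696448, 1838495783127395148684448111853568,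
   3353740663196590714900170894606336, 1838509648523408022241054816468992,
   3353768393988617547100450315567104, 1838510634723267252358956715081728,
   3353770366388318645943197925113856, 1838494796571985777328516530962432,
   3353738690085773057275373744553984, 3353748256608713478840865607909376,
   1838529785903312090606604957253632, 3353734391212700605125310753603584,
   1838502055111285258353342819729408]

/-- The columns of the contracting homotopy from degree `0` to the augmentation. -/
def homotopyCols0 : List ℕ :=
  [1, 0, 0, 0, 0, 0, 0, 0, 0, 0, 0, 0, 0, 0, 0, 0]

/-- The columns of the contracting homotopy from degree `1` to degree `0`. -/
def homotopyCols1 : List ℕ :=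
  [0, 0, 0, 0, 0, 0, 0, 0, 0, 0, 0, 0, 0, 0, 0, 42330, 0, 0, 0, 0, 0, 0, 0, 0, 0, 0, 0, 0, 0, 0,
   1290, 20640, 0, 0, 8208, 16416, 0, 0, 65022, 264, 32, 8272, 16544, 16, 8, 512, 1024, 62974]

/-- The columns of the contracting homotopy from degree `2` to degree `1`. -/
def homotopyCols2 : List ℕ :=
  [0, 0, 0, 0, 0, 0, 0, 0, 0, 0, 0, 0, 0, 0, 0, 252641280, 0, 0, 0, 0, 0, 0, 0, 0, 0, 0, 0,
   219454657449, 0, 0, 0, 219454638348, 0, 0, 0, 0, 0, 0, 0, 0, 0, 0, 0, 168121770, 0, 0,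
   168120480, 20640, 0, 0, 8256, 16512, 0, 77309437944, 219454659496, 77309436912, 16544, 64,
   128, 219353785939, 77309436920, 1, 77477525338, 512, 0, 0, 270532608, 541065216, 69278376528,
   214784025432, 69346009680, 214750753784, 710235562, 2097152, 4194304, 447042986,
   214750471000, 69278900816, 214884971512, 69261599312]

/-- The columns of the contracting homotopy from degree `3` to degree `2`. -/
def homotopyCols3 : List ℕ :=
  [0, 0, 0, 0, 0, 0, 0, 0, 0, 0, 0, 0, 0, 0, 0, 21930, 0, 0, 0, 0, 0, 0, 0, 5541860489628, 0, 0,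
   0, 0, 0, 0, 5541860490300, 2640, 0, 0, 0, 0, 0, 0, 0, 0, 0, 34078720, 101253120, 17039360,
   5106441875095552, 5106441346613248, 5106442421403648, 5106442147725312, 0, 0, 0, 0, 0, 0, 0,
   0, 0, 1104882436002, 6637338255456, 2256748438072, 55341129908616717376,
   55341112247693886560, 55341076925849338912, 55341100472213250554, 0, 0, 8193, 17826,
   36898590161991386721, 18451850519352182146, 36898590161991386145, 18451847196383395134,
   18451850519352182178, 36898590161991386209, 18451847196383395262, 36898590161991386737,
   17834, 1, 1442, 32767, 0, 18451547498409060251, 55340254796947596888, 36898331118841062331,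
   55345635088723550714, 36893794539203658715, 5406166929859128, 18447043830046484379,
   55340254796947072600, 36898331118807966651, 101384192, 18451547498425837467, 299794991637048,
   18452150271240005531, 55340537513401590266, 36898892115325682651]

/-- The columns of the contracting homotopy from degree `4` to degree `3`. -/
def homotopyCols4 : List ℕ :=
  [0, 0, 0, 0, 0, 0, 0, 0, 0, 0, 0, 0, 0, 0, 0, 23130, 0, 0, 0, 0, 0, 0, 0, 0, 0, 0, 0,
   4222124651668323, 0, 0, 0, 67553994411565923, 0, 0, 0, 0, 0, 0, 0, 47851841257472000, 0,
   38654705664, 42949672960, 51539607552, 584115552256, 47851738178256896, 171798691840,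
   309237645312, 0, 0, 0, 0, 0, 117375748728102703, 18504, 117375748728119633, 0, 0, 0, 0,
   16448, 117375748728119376, 514, 117375748728111473, 0, 0, 64176733064865819,
   11259875816667166, 90354125209994032, 9007250828187742, 73466000603493180, 47288685854799959,
   0, 55343610608433371165, 19140749391839810, 55377387343648340284, 1126312226849282,
   55458734282471201132, 63050420553802081, 55451978006850918764, 0, 47288685146683303,
   75716975432506508, 73466000256744652, 0, 9007250794633310, 126382926507230073,
   90354125193216816, 48414447616687613, 73466000256744588, 117375748728102831,
   47288685146701823, 126382926507213617, 63050420553868129, 512, 108368497933501297, 0, 0, 0,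
   0, 0, 0, 0, 1151051235328, 0, 0, 0, 18455752372514739910, 0, 0, 1208944312522115514459106,
   1208925856769777359467812]

end Data

section Resolution

noncomputable instance : Fintype GG := Fintype.ofEquiv _ centralProductEquiv.symm

/-- The differential from degree `0` to degree `1` in a minimal resolution of `ZMod 2` by
coregular representations. -/
noncomputable def diff0 : coregular (ZMod 2) GG (Fin 1) ⟶ coregular (ZMod 2) GG (Fin 3) :=
  diffHom centralProductEquiv centralProductEquiv_mul_inv diffCols0 (by decide +kernel)

/-- The differential from degree `1` to degree `2` in a minimal resolution of `ZMod 2` by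
coregular representations. -/
noncomputable def diff1 : coregular (ZMod 2) GG (Fin 3) ⟶ coregular (ZMod 2) GG (Fin 5) :=
  diffHom centralProductEquiv centralProductEquiv_mul_inv diffCols1 (by decide +kernel)

/-- The differential from degree `2` to degree `3` in a minimal resolution of `ZMod 2` by
coregular representations. -/
noncomputable def diff2 : coregular (ZMod 2) GG (Fin 5) ⟶ coregular (ZMod 2) GG (Fin 6) :=
  diffHom centralProductEquiv centralProductEquiv_mul_inv diffCols2 (by decide +kernel)

/-- The differential from degree `3` to degree `4` in a minimal resolution of `ZMod 2` by
coregular representations. -/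
noncomputable def diff3 : coregular (ZMod 2) GG (Fin 6) ⟶ coregular (ZMod 2) GG (Fin 7) :=
  diffHom centralProductEquiv centralProductEquiv_mul_inv diffCols3 (by decide +kernel)

/-- The embedding of the trivial representation as constant functions. -/
def augmentation : Rep.trivial (ZMod 2) GG (ZMod 2) ⟶ coregular (ZMod 2) GG (Fin 1) := Rep.ofHom
  { toLinearMap :=
      { toFun c _ := c
        map_add' _ _ := rfl
        map_smul' _ _ := rfl }
    isIntertwining' _ := rfl }

lemma augmentation_injective : Function.Injective augmentation.hom := fun _ _ h =>
  congrFun h (0, 1)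

lemma diff0_eq_zero_iff (v : Fin 1 × GG → ZMod 2) :
    diff0.hom v = 0 ↔ ∃ c, augmentation.hom c = v := by
  have h := diffHom_eq_zero_iff (r := 1) (s := 3) centralProductEquiv centralProductEquiv_mul_inv
    (Equiv.refl (Fin 1)) [65535] diffCols0 homotopyCols0 homotopyCols1 (by decide +kernel)
    rfl rfl rfl (by decide +kernel) (by decide +kernel) v
  have hP : bitMatrix (1 * 16) 1 ([65535].getD · 0) = bitMatrix (1 * 16) 1 blockOnes :=
    bitMatrix_congr (by decide)
  rw [hP] at h
  refine h.trans ⟨?_, ?_⟩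
  · rintro ⟨x, rfl⟩
    refine ⟨x 0, ((blockOnes_mulVec centralProductEquiv x).trans ?_).symm⟩
    exact funext fun p => congrArg x (Subsingleton.elim _ _)
  · rintro ⟨c, rfl⟩
    exact ⟨fun _ => c, blockOnes_mulVec centralProductEquiv _⟩

lemma diff1_eq_zero_iff (v : Fin 3 × GG → ZMod 2) :
    diff1.hom v = 0 ↔ ∃ x, diff0.hom x = v :=
  diffHom_eq_zero_iff centralProductEquiv centralProductEquiv_mul_inv
    (basisIndex centralProductEquiv 1) diffCols0 diffCols1 homotopyCols1 homotopyCols2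
    (by decide +kernel) rfl rfl rfl (by decide +kernel) (by decide +kernel) v

lemma diff2_eq_zero_iff (v : Fin 5 × GG → ZMod 2) :
    diff2.hom v = 0 ↔ ∃ x, diff1.hom x = v :=
  diffHom_eq_zero_iff centralProductEquiv centralProductEquiv_mul_inv
    (basisIndex centralProductEquiv 3) diffCols1 diffCols2 homotopyCols2 homotopyCols3
    (by decide +kernel) rfl rfl rfl (by decide +kernel) (by decide +kernel) v

lemma diff3_eq_zero_iff (v : Fin 6 × GG → ZMod 2) :
    diff3.hom v = 0 ↔ ∃ x, diff2.hom x = v :=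
  diffHom_eq_zero_iff centralProductEquiv centralProductEquiv_mul_inv
    (basisIndex centralProductEquiv 5) diffCols2 diffCols3 homotopyCols3 homotopyCols4
    (by decide +kernel) rfl rfl rfl (by decide +kernel) (by decide +kernel) v

/-- Dimension shifting from a morphism into a coregular representation to its successor. -/
lemma finrank_groupCohomology_imageRep {A : Rep (ZMod 2) GG} {α : Type} {C : Rep (ZMod 2) GG}
    (d : A ⟶ coregular (ZMod 2) GG α) (d' : coregular (ZMod 2) GG α ⟶ C)
    (hex : ∀ v, d'.hom v = 0 ↔ ∃ x, d.hom x = v) (n : ℕ) :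
    Module.finrank (ZMod 2) (groupCohomology (imageRep d) (n + 2)) =
      Module.finrank (ZMod 2) (groupCohomology (imageRep d') (n + 1)) :=
  finrank_groupCohomology_add_two (imageRepι d) d' Subtype.val_injective
    (fun v => (hex v).trans ⟨fun ⟨x, hx⟩ => ⟨⟨v, x, hx⟩, rfl⟩, fun ⟨w, hw⟩ => hw ▸ w.2⟩) n

lemma finrank_groupCohomology_imageRep_one {A : Rep (ZMod 2) GG} {α : Type}
    {C : Rep (ZMod 2) GG}
    (d : A ⟶ coregular (ZMod 2) GG α) (d' : coregular (ZMod 2) GG α ⟶ C)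
    (hex : ∀ v, d'.hom v = 0 ↔ ∃ x, d.hom x = v)
    (hinv : ∀ v ∈ (coregularRho (ZMod 2) GG α).invariants, d'.hom v = 0) :
    Module.finrank (ZMod 2) (groupCohomology (imageRep d) 1) =
      Module.finrank (ZMod 2) (imageRep d').ρ.invariants :=
  finrank_groupCohomology_one (imageRepι d) d' Subtype.val_injective
    (fun v => (hex v).trans ⟨fun ⟨x, hx⟩ => ⟨⟨v, x, hx⟩, rfl⟩, fun ⟨w, hw⟩ => hw ▸ w.2⟩) hinv

lemma finrank_invariants_imageRep_diffHom {r s : ℕ} (D T : List ℕ)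
    (hD : IsTranslationInvariant r s D) (hlen : D.length = r * 16) (hT : T.length = s * 16)
    (h : ∀ i < s, bitApply D (bitApply T (blockOnes i)) = blockOnes i) :
    Module.finrank (ZMod 2) (imageRep (diffHom centralProductEquiv centralProductEquiv_mul_inv D
      hD)).ρ.invariants = s :=
  (finrank_invariants_imageRep _ (exists_diffHom_eq _ _ D hD hlen T hT h)).trans
    (Fintype.card_fin s)

end Resolution

/-- The mod-2 Betti numbers `hⁱ = dim H^i(G; 𝔽₂)` of `G = D₈ ∗ C₄` in degrees `0,…,4` are
`1, 3, 5, 6, 7`. -/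
theorem betti_numbers_low_degrees :
    Module.finrank (ZMod 2) (groupCohomology (Rep.trivial (ZMod 2) GG (ZMod 2)) 0) = 1 ∧
    Module.finrank (ZMod 2) (groupCohomology (Rep.trivial (ZMod 2) GG (ZMod 2)) 1) = 3 ∧
    Module.finrank (ZMod 2) (groupCohomology (Rep.trivial (ZMod 2) GG (ZMod 2)) 2) = 5 ∧
    Module.finrank (ZMod 2) (groupCohomology (Rep.trivial (ZMod 2) GG (ZMod 2)) 3) = 6 ∧
    Module.finrank (ZMod 2) (groupCohomology (Rep.trivial (ZMod 2) GG (ZMod 2)) 4) = 7 := by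
  have shift := finrank_groupCohomology_add_two augmentation diff0 augmentation_injective
    diff0_eq_zero_iff
  refine ⟨?_, ?_, ?_, ?_, ?_⟩
  · exact (H0IsoOfIsTrivial _).toLinearEquiv.finrank_eq.trans (Module.finrank_self _)
  · rw [finrank_groupCohomology_one augmentation diff0 augmentation_injective diff0_eq_zero_iff
      (diffHom_eq_zero_of_mem_invariants _ _ _ _ rfl (by decide +kernel))]
    exact finrank_invariants_imageRep_diffHom _ homotopyCols1 _ rfl rfl (by decide +kernel)
  · rw [shift 0, finrank_groupCohomology_imageRep_one diff0 diff1 diff1_eq_zero_iff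
      (diffHom_eq_zero_of_mem_invariants _ _ _ _ rfl (by decide +kernel))]
    exact finrank_invariants_imageRep_diffHom _ homotopyCols2 _ rfl rfl (by decide +kernel)
  · rw [shift 1, finrank_groupCohomology_imageRep diff0 diff1 diff1_eq_zero_iff,
      finrank_groupCohomology_imageRep_one diff1 diff2 diff2_eq_zero_iff
      (diffHom_eq_zero_of_mem_invariants _ _ _ _ rfl (by decide +kernel))]
    exact finrank_invariants_imageRep_diffHom _ homotopyCols3 _ rfl rfl (by decide +kernel)
  · rw [shift 2, finrank_groupCohomology_imageRep diff0 diff1 diff1_eq_zero_iff,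
      finrank_groupCohomology_imageRep diff1 diff2 diff2_eq_zero_iff,
      finrank_groupCohomology_imageRep_one diff2 diff3 diff3_eq_zero_iff
      (diffHom_eq_zero_of_mem_invariants _ _ _ _ rfl (by decide +kernel))]
    exact finrank_invariants_imageRep_diffHom _ homotopyCols4 _ rfl rfl (by decide +kernel)
end

section
/- The Poincaré series of the mod-2 cohomology of G = D₈ ∗ C₄ satisfies (1 − t)²(1 + t²) · Σ_{i≥0} hⁱ tⁱ = 1 + t + t² as formal power series, where hⁱ = dim_{𝔽₂} Hⁱ(G; 𝔽₂); equivalently, Σ_{i≥0} hⁱ tⁱ = (1 + t + t²)/((1 − t)²(1 + t²)). -/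
/-!
Let `D8 = ⟨σ, ρ⟩` be the dihedral group of order 8 (`ρ` of order 4, `σ` of order 2,
`σρσ⁻¹ = ρ⁻¹`) and `C4 = ⟨γ⟩` the cyclic group of order 4.  The central product
`G = D8 ∗ C4` is the quotient of `D8 × C4` by the central subgroup generated by `ρ²γ⁻²`.
We model `D8` as `DihedralGroup 4` (with `ρ = r 1`, `σ = sr 0`) and `C4` as
`Multiplicative (ZMod 4)`.
-/

open DihedralGroup

namespace groupCohomology

open CategoryTheory

universe u

section General

variable {k G : Type u} [Field k] [Group G]

instance moduleFinite [Finite G] (A : Rep k G) [Module.Finite k A] (n : ℕ) :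
    Module.Finite k (groupCohomology A n) := by
  have : Module.Finite k ((inhomogeneousCochains A).X n) :=
    inferInstanceAs (Module.Finite k ((Fin n → G) → A))
  have : Module.Finite k (cocycles A n) :=
    Module.Finite.of_injective (iCocycles A n).hom
      ((ModuleCat.mono_iff_injective _).1 inferInstance)
  exact Module.Finite.of_surjective (π A n).hom fun x =>
    groupCohomology_induction_on x fun y => ⟨y, rfl⟩

/-- A representation `A` of a finite group has no higher cohomology as soon as its identity is the
trace `∑ g, g φ g⁻¹` of a linear endomorphism `φ`. -/
lemma isZero_succ_of_sum_conj_eq [Fintype G] (A : Rep k G) (φ : A →ₗ[k] A)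
    (hφ : ∀ m, ∑ g, A.ρ g⁻¹ (φ (A.ρ g m)) = m) (n : ℕ) :
    Limits.IsZero (groupCohomology A (n + 1)) := by
  let B : Rep k (⊥ : Subgroup G) := Rep.trivial k _ A
  let a : A ⟶ Rep.coind (⊥ : Subgroup G).subtype B := Rep.ofHom
    { toFun m := ⟨fun g => φ (A.ρ g m), by
        rintro ⟨s, hs⟩ h
        obtain rfl := Subgroup.mem_bot.1 hs
        simp [B]⟩
      map_add' _ _ := by ext; simp
      map_smul' _ _ := by ext; simp
      isIntertwining' h := by
        ext m g
        change φ (A.ρ g (A.ρ h m)) = φ (A.ρ (g * h) m)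
        simp }
  let b : Rep.coind (⊥ : Subgroup G).subtype B ⟶ A := Rep.ofHom
    { toFun f := ∑ g, A.ρ g⁻¹ (f.1 g)
      map_add' _ _ := by simp [Finset.sum_add_distrib]
      map_smul' _ _ := by simp [Finset.smul_sum]
      isIntertwining' h := by
        ext f
        simp only [LinearMap.comp_apply, LinearMap.coe_mk, AddHom.coe_mk, map_sum]
        refine Fintype.sum_equiv (Equiv.mulRight h) _ _ fun g => ?_
        change A.ρ g⁻¹ (f.1 (g * h)) = A.ρ h (A.ρ (g * h)⁻¹ (f.1 (g * h)))
        simp [← Module.End.mul_apply, ← map_mul] }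
  have hab : a ≫ b = 𝟙 A := by
    ext m
    exact hφ m
  have h0 : Limits.IsZero (groupCohomology (Rep.coind (⊥ : Subgroup G).subtype B) (n + 1)) :=
    (isZero_groupCohomology_succ_of_subsingleton B n).of_iso (coindIso B (n + 1))
  rw [Limits.IsZero.iff_id_eq_zero, ← map_id, ← hab, map_id_comp,
    h0.eq_of_tgt (map (MonoidHom.id G) a (n + 1)) 0]
  exact Limits.zero_comp

lemma functor_map_zero_eq {A B : Rep k G} (f : A ⟶ B) : (functor k G 0).map f =
    ((H0Iso A).hom ≫ (Rep.invariantsFunctor k G).map f ≫ (H0Iso B).inv : H0 A ⟶ H0 B) := by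
  have h : map (MonoidHom.id G) f 0 =
      (H0Iso A).hom ≫ (Rep.invariantsFunctor k G).map f ≫ (H0Iso B).inv := by
    rw [← Category.assoc, Iso.eq_comp_inv, map_id_comp_H0Iso_hom]
  exact h

lemma functor_map_zero_eq_zero {A B : Rep k G} (f : A ⟶ B)
    (hf : ∀ a, (∀ g, A.ρ g a = a) → f a = 0) : (functor k G 0).map f = 0 := by
  have h : (Rep.invariantsFunctor k G).map f = 0 := by
    ext a
    exact Subtype.ext (hf a.1 a.2)
  rw [functor_map_zero_eq, h, Limits.zero_comp, Limits.comp_zero]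
  rfl

lemma epi_functor_map_zero {A B : Rep k G} (f : A ⟶ B)
    (hf : ∀ b, (∀ g, B.ρ g b = b) → ∃ a, (∀ g, A.ρ g a = a) ∧ f a = b) :
    Epi ((functor k G 0).map f) := by
  have h : Epi ((Rep.invariantsFunctor k G).map f) := by
    rw [ModuleCat.epi_iff_surjective]
    intro b
    obtain ⟨a, ha, hab⟩ := hf b.1 b.2
    exact ⟨⟨a, ha⟩, Subtype.ext hab⟩
  have h' : Epi ((H0Iso A).hom ≫ (Rep.invariantsFunctor k G).map f ≫ (H0Iso B).inv) :=
    inferInstance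
  rw [functor_map_zero_eq]
  exact h'

end General

section Sign

variable {G : Type} [Group G] (χ : G →* Multiplicative (ZMod 2))

/-- The representation induced from the restriction of `A` to the kernel of `χ`, realised as pairs
of elements of `A`, which `χ` permutes. -/
def signInd (A : Rep.{0} (ZMod 2) G) : Rep.{0} (ZMod 2) G :=
  Rep.of (X := ZMod 2 → A)
    { toFun g :=
        { toFun f y := A.ρ g (f (y + (χ g).toAdd))
          map_add' _ _ := by ext; simp
          map_smul' _ _ := by ext; simp }
      map_one' := by ext; simp
      map_mul' g h := by ext; simp [add_assoc] }

/-- Functoriality of `signInd`. -/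
def signIndMap {A B : Rep (ZMod 2) G} (φ : A ⟶ B) : signInd χ A ⟶ signInd χ B :=
  Rep.ofHom
    { toFun f y := φ (f y)
      map_add' _ _ := by ext; simp
      map_smul' _ _ := by ext; simp
      isIntertwining' g := LinearMap.ext fun f => funext fun y => Rep.hom_comm_apply φ g _ }

/-- The diagonal embedding of `A` into `signInd χ A`. -/
def signIndUnit (A : Rep (ZMod 2) G) : A ⟶ signInd χ A :=
  Rep.ofHom
    { toFun a _ := a
      map_add' _ _ := rfl
      map_smul' _ _ := rfl
      isIntertwining' _ := rfl }

/-- The sum of the two coordinates, as a map from `signInd χ A` to `A`. -/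
def signIndCounit (A : Rep (ZMod 2) G) : signInd χ A ⟶ A :=
  Rep.ofHom
    { toFun f := f 0 + f 1
      map_add' _ _ := by exact add_add_add_comm _ _ _ _
      map_smul' c f := (smul_add c (f 0) (f 1)).symm
      isIntertwining' g := LinearMap.ext fun f => by
        change A.ρ g (f (0 + (χ g).toAdd)) + A.ρ g (f (1 + (χ g).toAdd)) = A.ρ g (f 0 + f 1)
        obtain h | h : (χ g).toAdd = 0 ∨ (χ g).toAdd = 1 := by
          generalize (χ g).toAdd = z
          revert z
          decide
        · simp [h]
        · rw [h, map_add, add_comm, zero_add, show (1 + 1 : ZMod 2) = 0 from rfl] }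

variable {χ}

lemma shortExact_of_hom {X : ShortComplex (Rep (ZMod 2) G)} (hf : Function.Injective X.f)
    (hg : Function.Surjective X.g) (hfg : ∀ x, X.g x = 0 → ∃ y, X.f y = x) :
    X.ShortExact := by
  have : Mono X.f := (Rep.mono_iff_injective _).2 hf
  have : Epi X.g := (Rep.epi_iff_surjective _).2 hg
  refine ⟨?_⟩
  rw [← ShortComplex.exact_map_iff_of_faithful _ (forget₂ (Rep (ZMod 2) G) (ModuleCat (ZMod 2)))]
  rw [ShortComplex.moduleCat_exact_iff]
  exact hfg

variable (χ) in
/-- The short complex `A ⟶ signInd χ A ⟶ A`. -/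
abbrev gysinShortComplex (A : Rep (ZMod 2) G) : ShortComplex (Rep (ZMod 2) G) :=
  ShortComplex.mk (signIndUnit χ A) (signIndCounit χ A) (by
    ext a
    exact ZModModule.add_self (a : A))

lemma shortExact_gysinShortComplex (A : Rep (ZMod 2) G) : (gysinShortComplex χ A).ShortExact := by
  refine shortExact_of_hom (fun a b h => congrFun h 0) (fun a => ⟨Pi.single 0 a, ?_⟩)
    (fun f hf => ⟨f 0, funext fun y => ?_⟩)
  · change (Pi.single 0 a : ZMod 2 → A) 0 + (Pi.single 0 a : ZMod 2 → A) 1 = a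
    simp
  · have h01 : f 0 = f 1 := by
      rw [← sub_eq_zero, ZModModule.sub_eq_add]
      exact hf
    fin_cases y
    exacts [rfl, h01]

/-- The image of a short complex under `signInd`. -/
abbrev signIndShortComplex (X : ShortComplex (Rep (ZMod 2) G)) : ShortComplex (Rep (ZMod 2) G) where
  X₁ := signInd χ X.X₁
  X₂ := signInd χ X.X₂
  X₃ := signInd χ X.X₃
  f := signIndMap χ X.f
  g := signIndMap χ X.g
  zero := by
    ext f
    funext y
    exact congrArg (fun φ : X.X₁ ⟶ X.X₃ => φ (f y)) X.zero

/-- The diagonal embedding of a short complex into its image under `signInd`. -/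
def toSignIndShortComplex (X : ShortComplex (Rep (ZMod 2) G)) :
    X ⟶ signIndShortComplex (χ := χ) X where
  τ₁ := signIndUnit χ X.X₁
  τ₂ := signIndUnit χ X.X₂
  τ₃ := signIndUnit χ X.X₃

section Step

variable {X : ShortComplex (Rep (ZMod 2) G)} (hX : X.ShortExact)
include hX

lemma shortExact_signIndShortComplex : (signIndShortComplex (χ := χ) X).ShortExact := by
  have hf := (Rep.mono_iff_injective _).1 hX.mono_f
  have hg := (Rep.epi_iff_surjective _).1 hX.epi_g
  have hfg := (ShortComplex.moduleCat_exact_iff _).1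
    (hX.exact.map (forget₂ (Rep (ZMod 2) G) (ModuleCat (ZMod 2))))
  refine shortExact_of_hom (fun a b h => funext fun y => hf (congrFun h y))
    (fun a => ?_) (fun f hf => ?_)
  · choose b hb using fun y => hg (a y)
    exact ⟨b, funext hb⟩
  · choose b hb using fun y => hfg (f y) (congrFun hf y)
    exact ⟨b, funext hb⟩

variable (h : ∀ n, Limits.IsZero (groupCohomology (signInd χ X.X₂) (n + 1)))
include h

/-- Dimension shifting for surjectivity of the restriction to the kernel of `χ`. -/
lemma epi_map_signIndUnit_succ (n : ℕ)
    (hn : Epi ((functor (ZMod 2) G n).map (signIndUnit χ X.X₃))) :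
    Epi ((functor (ZMod 2) G (n + 1)).map (signIndUnit χ X.X₁)) := by
  have hX' := shortExact_signIndShortComplex (χ := χ) hX
  have hnat := δ_naturality hX hX' (toSignIndShortComplex X) n (n + 1) rfl
  have : Epi ((functor (ZMod 2) G n).map (toSignIndShortComplex (χ := χ) X).τ₃) := hn
  have := epi_comp' this (epi_δ_of_isZero hX' n (h n))
  exact @epi_of_epi_fac _ _ _ _ _ _ _ _ this hnat

/-- Dimension shifting for the cohomology of the kernel of `χ`. -/
lemma finrank_signInd_succ (h0 : (functor (ZMod 2) G 0).map (signIndMap χ X.g) = 0) (n : ℕ) :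
    Module.finrank (ZMod 2) (groupCohomology (signInd χ X.X₁) (n + 1)) =
      Module.finrank (ZMod 2) (groupCohomology (signInd χ X.X₃) n) := by
  have hX' := shortExact_signIndShortComplex (χ := χ) hX
  have := epi_δ_of_isZero hX' n (h n)
  have hzero : (functor (ZMod 2) G n).map (signIndMap χ X.g) = 0 := by
    cases n with
    | zero => exact h0
    | succ n => exact (h n).eq_of_src _ _
  have : Mono (δ hX' n (n + 1) rfl) := (mapShortComplex₃_exact hX' rfl).mono_g hzero
  have : IsIso (δ hX' n (n + 1) rfl) := isIso_of_mono_of_epi _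
  exact (asIso (δ hX' n (n + 1) rfl)).toLinearEquiv.finrank_eq.symm

end Step

/-- The Gysin sequence of the kernel of `χ`, when restriction is surjective. -/
lemma finrank_succ_of_epi [Finite G] (A : Rep (ZMod 2) G) [Module.Finite (ZMod 2) A]
    (h : ∀ n, Epi ((functor (ZMod 2) G n).map (signIndUnit χ A))) (n : ℕ) :
    Module.finrank (ZMod 2) (groupCohomology A (n + 1)) =
      Module.finrank (ZMod 2) (groupCohomology A n) +
        Module.finrank (ZMod 2) (groupCohomology (signInd χ A) (n + 1)) := by
  have hX := shortExact_gysinShortComplex (χ := χ) A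
  have hzero : (functor (ZMod 2) G n).map (signIndCounit χ A) = 0 := by
    have := h n
    rw [← cancel_epi ((functor (ZMod 2) G n).map (signIndUnit χ A)), Limits.comp_zero]
    exact (mapShortComplex₂ (gysinShortComplex χ A) n).zero
  have hmono : Mono (δ hX n (n + 1) rfl) := (mapShortComplex₃_exact hX rfl).mono_g hzero
  have hex := (mapShortComplex₁_exact hX (rfl : n + 1 = n + 1)).moduleCat_range_eq_ker
  have : Module.Finite (ZMod 2) ((functor (ZMod 2) G (n + 1)).obj A) := moduleFinite A (n + 1)
  have hrk := ((functor (ZMod 2) G (n + 1)).map (signIndUnit χ A)).hom.finrank_range_add_finrank_ker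
  rw [LinearMap.range_eq_top.2 ((ModuleCat.epi_iff_surjective _).1 (h (n + 1))), finrank_top] at hrk
  refine hrk.symm.trans ((add_comm _ _).trans (congrArg (· + _) ?_))
  refine (congrArg (fun S : Submodule (ZMod 2) _ => Module.finrank (ZMod 2) S) hex.symm).trans ?_
  exact LinearMap.finrank_range_of_inj ((ModuleCat.mono_iff_injective _).1 hmono)

end Sign

end groupCohomology

namespace GG

open CategoryTheory QuaternionGroup groupCohomology

/-- The number of free summands in each term of the periodic complex. -/
def rank : Fin 4 → ℕ := ![1, 2, 2, 1]

/-- The index set of the standard basis of each term of the periodic complex. -/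
abbrev Basis (i : Fin 4) : Type := Fin (rank i) × QuaternionGroup 2

/-- The quaternions of order four twisting the action on each component. -/
def twist (i : Fin 4) (c : Fin (rank i)) : QuaternionGroup 2 :=
  (![[xa 0], [xa 0, xa 1], [xa 1, a 1], [a 1]] i).getD c 1

/-- The left multiplier of the action of `D8 × C4` on a component. -/
def leftMul (i : Fin 4) (c : Fin (rank i)) : D8 × C4 → QuaternionGroup 2
  | (.r _, m) => twist i c ^ m.toAdd.val
  | (.sr _, m) => twist i c ^ (m.toAdd.val + 1)

/-- The right multiplier of the action of `D8 × C4` on every component. -/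
def rightMul : D8 × C4 → QuaternionGroup 2
  | (.r k, _) => a k
  | (.sr k, _) => xa k

/-- The sign by which both multipliers fail to be multiplicative. -/
def sign : D8 × C4 → D8 × C4 → QuaternionGroup 2
  | (.sr _, _), (.sr _, _) => a 2
  | _, _ => 1

/-- The right action of `D8 × C4` on the basis of a term of the periodic complex. -/
def act (i : Fin 4) (g : D8 × C4) (p : Basis i) : Basis i :=
  (p.1, leftMul i p.1 g * p.2 * rightMul g)

lemma leftMul_mul : ∀ i c g h,
    leftMul i c (g * h) = sign g h * leftMul i c h * leftMul i c g := by
  decide +kernel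

lemma rightMul_mul : ∀ g h, rightMul (g * h) = sign g h * rightMul g * rightMul h := by
  decide +kernel

lemma sign_mul_self : ∀ g h, sign g h * sign g h = 1 := by decide +kernel

lemma sign_comm : ∀ g h x, x * sign g h = sign g h * x := by decide +kernel

lemma act_one : ∀ i p, act i 1 p = p := by decide +kernel

lemma act_mul (i : Fin 4) (g h : D8 × C4) (p : Basis i) :
    act i (g * h) p = act i h (act i g p) := by
  refine Prod.ext rfl ?_
  have h : leftMul i p.1 (g * h) * p.2 * rightMul (g * h) =
      leftMul i p.1 h * leftMul i p.1 g * p.2 * (sign g h * sign g h) * rightMul g *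
        rightMul h := by
    rw [leftMul_mul, rightMul_mul, mul_assoc (sign g h), mul_assoc (sign g h), ← sign_comm]
    simp only [mul_assoc]
  simp only [act, h, sign_mul_self, mul_one, mul_assoc]

lemma act_zEl : ∀ i p, act i zEl p = p := by decide +kernel

/-- The support of the blocks of the differential: the entry from component `c` to component `c'`
sums the translates by these quaternions. -/
def support : (i : Fin 4) → Fin (rank i) → Fin (rank (i + 1)) → Finset (QuaternionGroup 2)
  | 0 => ![![{1, xa 0}, {1, a 1}]]
  | 1 => ![![{1, a 1}, {1, xa 3}], ![{1, xa 1}, {1, xa 0}]]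
  | 2 => ![![{1, xa 0}], ![{1, a 1}]]
  | 3 => ![![Finset.univ]]

/-- The matrix of the differential. -/
def diff (i : Fin 4) : Matrix (Basis (i + 1)) (Basis i) (ZMod 2) :=
  .of fun p q => if q.2 * p.2⁻¹ ∈ support i q.1 p.1 then 1 else 0

/-- The position of a quaternion in the list `1, i, -1, -i, j, …`. -/
def position : QuaternionGroup 2 → ℕ
  | .a n => n.val
  | .xa n => 4 + n.val

/-- The rows of the contracting homotopy, as bit masks. -/
def homotopyRows : Fin 4 → List ℕ :=
  ![[2048, 2304, 1024, 0, 1040, 18496, 2112, 8],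
    [4104, 16384, 2052, 0, 0, 64, 0, 2176, 0, 18438, 0, 0, 4096, 12360, 0, 2048],
    [64, 0, 0, 0, 144, 32, 0, 0, 8, 38, 4, 0, 0, 0, 0, 128],
    [8]]

/-- A contracting homotopy of the periodic complex. -/
def homotopy (i : Fin 4) : Matrix (Basis i) (Basis (i + 1)) (ZMod 2) :=
  .of fun p q => if ((homotopyRows i).getD (8 * p.1 + position p.2) 0).testBit
    (8 * q.1 + position q.2) then 1 else 0

lemma support_leftMul : ∀ i g c c' u,
    leftMul i c g * u * (leftMul (i + 1) c' g)⁻¹ ∈ support i c c' ↔ u ∈ support i c c' := by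
  decide +kernel

lemma diff_act (i : Fin 4) (g : D8 × C4) (p : Basis (i + 1)) (q : Basis i) :
    diff i (act (i + 1) g p) (act i g q) = diff i p q := by
  have h : leftMul i q.1 g * q.2 * rightMul g * (leftMul (i + 1) p.1 g * p.2 * rightMul g)⁻¹ =
      leftMul i q.1 g * (q.2 * p.2⁻¹) * (leftMul (i + 1) p.1 g)⁻¹ := by group
  simp only [diff, act, Matrix.of_apply, h, support_leftMul]

lemma diff_mul_diff : ∀ i, diff (i + 1) * diff i = 0 := by
  decide +kernel

lemma diff_mul_homotopy_add : ∀ i, diff i * homotopy i + homotopy (i + 1) * diff (i + 1) = 1 := by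
  decide +kernel

lemma sum_diff_eq_zero : ∀ i p c, ∑ x, diff i p (c, x) = 0 := by decide +kernel

/-- The character of `D8 × C4` whose kernel is a quaternion group modulo `zEl`. -/
def character : D8 × C4 →* Multiplicative (ZMod 2) where
  toFun
    | (.r _, m) => .ofAdd (m.toAdd.val : ZMod 2)
    | (.sr _, m) => .ofAdd (m.toAdd.val + 1 : ZMod 2)
  map_one' := rfl
  map_mul' := by decide +kernel

lemma character_zEl : character zEl = 1 := rfl

lemma exists_act_snd_eq_one : ∀ i (p : Basis i) y, ∃ g, character g = y ∧ (act i g p).2 = 1 ∧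
    ∀ h, character h = y → (act i h p).2 = 1 → h = g ∨ h = g * zEl := by
  decide +kernel

/-- The right action of `GG` on the basis of a term of the periodic complex. -/
def actHom (i : Fin 4) : GG →* (Function.End (Basis i))ᵐᵒᵖ :=
  QuotientGroup.lift Zc
    { toFun g := .op (act i g)
      map_one' := congrArg MulOpposite.op (funext (act_one i))
      map_mul' g h := congrArg MulOpposite.op (funext (act_mul i g h)) }
    ((Subgroup.zpowers_le (H := MonoidHom.ker _)).2
      (congrArg MulOpposite.op (funext (act_zEl i))))

/-- The right action of `GG` on the basis of a term of the periodic complex, as a function. -/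
def gact (i : Fin 4) (g : GG) (p : Basis i) : Basis i := (actHom i g).unop p

lemma gact_mul (i : Fin 4) (g h : GG) (p : Basis i) : gact i (g * h) p = gact i h (gact i g p) :=
  congrArg (fun f : (Function.End (Basis i))ᵐᵒᵖ => f.unop p) (map_mul (actHom i) g h)

lemma gact_one (i : Fin 4) (p : Basis i) : gact i 1 p = p :=
  congrArg (fun f : (Function.End (Basis i))ᵐᵒᵖ => f.unop p) (map_one (actHom i))

lemma gact_bijective (i : Fin 4) (g : GG) : Function.Bijective (gact i g) :=
  Function.bijective_iff_has_inverse.2 ⟨gact i g⁻¹,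
    fun p => by rw [← gact_mul, mul_inv_cancel, gact_one],
    fun p => by rw [← gact_mul, inv_mul_cancel, gact_one]⟩

lemma gact_fst (i : Fin 4) (g : GG) (p : Basis i) : (gact i g p).1 = p.1 := by
  induction g using QuotientGroup.induction_on
  rfl

lemma diff_gact (i : Fin 4) (g : GG) (p : Basis (i + 1)) (q : Basis i) :
    diff i (gact (i + 1) g p) (gact i g q) = diff i p q := by
  induction g using QuotientGroup.induction_on with
  | H g => exact diff_act i g p q

/-- The character of `GG` whose kernel is a quaternion group. -/
def χ : GG →* Multiplicative (ZMod 2) :=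
  QuotientGroup.lift Zc character
    ((Subgroup.zpowers_le (H := MonoidHom.ker _)).2 character_zEl)

lemma existsUnique_gact_snd_eq_one (i : Fin 4) (p : Basis i) (y : ZMod 2) :
    ∃! g : GG, (χ g).toAdd = y ∧ (gact i g p).2 = 1 := by
  obtain ⟨g, hg, hg', h⟩ := exists_act_snd_eq_one i p (.ofAdd y)
  refine ⟨g, ⟨congrArg Multiplicative.toAdd hg, hg'⟩, fun k => ?_⟩
  induction k using QuotientGroup.induction_on with
  | H k =>
    rintro ⟨hk, hk'⟩
    obtain rfl | rfl := h k (congrArg Multiplicative.ofAdd hk) hk'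
    · rfl
    · exact QuotientGroup.mk_mul_of_mem g (Subgroup.mem_zpowers zEl)

/-- The terms of the periodic complex. -/
def term (i : Fin 4) : Rep.{0} (ZMod 2) GG :=
  Rep.of (X := Basis i → ZMod 2)
    { toFun g := LinearMap.funLeft (ZMod 2) (ZMod 2) (gact i g)
      map_one' := by
        ext f p
        simp [LinearMap.funLeft_apply, gact_one]
      map_mul' g h := by
        ext f p
        simp [LinearMap.funLeft_apply, gact_mul] }

lemma diff_mulVec_ρ (i : Fin 4) (g : GG) (f : Basis i → ZMod 2) :
    (diff i).mulVec ((term i).ρ g f) = (term (i + 1)).ρ g ((diff i).mulVec f) := by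
  funext p
  refine (Fintype.sum_bijective _ (gact_bijective i g) _ _ fun q => ?_)
  change diff i p q * f (gact i g q) = diff i (gact (i + 1) g p) (gact i g q) * f (gact i g q)
  rw [diff_gact]

/-- The cocycles in the terms of the periodic complex. -/
def cocycle (i : Fin 4) : Rep.{0} (ZMod 2) GG :=
  (term i).subrepresentation (LinearMap.ker (diff i).mulVecLin) fun g f hf => by
    have hf' : (diff i).mulVec f = 0 := hf
    exact (diff_mulVec_ρ i g f).trans
      ((congrArg ((term (i + 1)).ρ g) hf').trans (map_zero ((term (i + 1)).ρ g)))

instance (i : Fin 4) : Module.Finite (ZMod 2) (cocycle i) :=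
  inferInstanceAs (Module.Finite (ZMod 2) (LinearMap.ker (diff i).mulVecLin))

lemma exists_diff_mulVec_eq (i : Fin 4) (f : Basis (i + 1) → ZMod 2)
    (hf : (diff (i + 1)).mulVec f = 0) : ∃ f', (diff i).mulVec f' = f := by
  refine ⟨(homotopy i).mulVec f, ?_⟩
  have h := congrArg (Matrix.mulVec · f) (diff_mul_homotopy_add i)
  simpa [Matrix.add_mulVec, ← Matrix.mulVec_mulVec, hf] using h

/-- The short complex relating consecutive cocycles. -/
def cocycleShortComplex (i : Fin 4) : ShortComplex (Rep.{0} (ZMod 2) GG) where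
  X₁ := cocycle i
  X₂ := term i
  X₃ := cocycle (i + 1)
  f := Rep.subtype _ _ _
  g := Rep.ofHom
    { toLinearMap := (diff i).mulVecLin.codRestrict _ fun f => by
        change (diff (i + 1)).mulVec ((diff i).mulVec f) = 0
        rw [Matrix.mulVec_mulVec, diff_mul_diff, Matrix.zero_mulVec]
      isIntertwining' g := LinearMap.ext fun f => Subtype.ext (diff_mulVec_ρ i g f) }
  zero := by
    ext f
    exact Subtype.ext f.2

lemma shortExact_cocycleShortComplex (i : Fin 4) : (cocycleShortComplex i).ShortExact := by
  refine shortExact_of_hom Subtype.val_injective (fun f => ?_) (fun f hf => ?_)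
  · obtain ⟨f', hf'⟩ := exists_diff_mulVec_eq i f.1 f.2
    exact ⟨f', Subtype.ext hf'⟩
  · exact ⟨⟨f, congrArg Subtype.val hf⟩, rfl⟩

lemma isZero_signInd_term (i : Fin 4) (n : ℕ) :
    Limits.IsZero (groupCohomology (signInd χ (term i)) (n + 1)) := by
  have := Fintype.ofFinite GG
  let φ : (ZMod 2 → Basis i → ZMod 2) →ₗ[ZMod 2] (ZMod 2 → Basis i → ZMod 2) :=
    { toFun F y p := if y = 0 ∧ p.2 = 1 then F y p else 0
      map_add' F F' := by
        ext y p
        simp only [Pi.add_apply]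
        split <;> simp
      map_smul' c F := by
        ext y p
        simp }
  refine isZero_succ_of_sum_conj_eq (signInd χ (term i)) φ (fun F => ?_) n
  have key (g : GG) : (signInd χ (term i)).ρ g⁻¹ (φ ((signInd χ (term i)).ρ g F)) = fun y p =>
      if y + (χ g⁻¹).toAdd = 0 ∧ (gact i g⁻¹ p).2 = 1 then F y p else 0 := by
    funext y p
    change (if y + (χ g⁻¹).toAdd = 0 ∧ (gact i g⁻¹ p).2 = 1 then
      F (y + (χ g⁻¹).toAdd + (χ g).toAdd) (gact i g (gact i g⁻¹ p)) else 0) = _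
    rw [← gact_mul, inv_mul_cancel, gact_one, map_inv, toAdd_inv, neg_add_cancel_right]
  refine (Finset.sum_congr rfl fun g _ => key g).trans ?_
  change (∑ g : GG, fun (y : ZMod 2) (p : Basis i) =>
    if y + (χ g⁻¹).toAdd = 0 ∧ (gact i g⁻¹ p).2 = 1 then F y p else (0 : ZMod 2)) = F
  funext y p
  obtain ⟨g, ⟨hg, hone⟩, h⟩ := existsUnique_gact_snd_eq_one i p (-y)
  rw [Finset.sum_apply, Finset.sum_apply, Fintype.sum_eq_single g⁻¹ fun k hk => if_neg fun hk' =>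
    hk (inv_eq_iff_eq_inv.1 (h k⁻¹ ⟨(neg_eq_of_add_eq_zero_right hk'.1).symm, hk'.2⟩))]
  rw [inv_inv, if_pos ⟨by rw [hg, add_neg_cancel], hone⟩]

/-- An invariant element of `signInd χ (term i)` only depends on the component. -/
lemma eq_of_mem_invariants (i : Fin 4) (F : ZMod 2 → Basis i → ZMod 2)
    (hF : ∀ (g : GG) y p, F (y + (χ g).toAdd) (gact i g p) = F y p) (y : ZMod 2) (p : Basis i) :
    F y p = F 0 (p.1, 1) := by
  obtain ⟨g, ⟨hg, hg'⟩, -⟩ := existsUnique_gact_snd_eq_one i p (-y)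
  rw [← hF g, hg, add_neg_cancel]
  exact congrArg (F 0) (Prod.ext (gact_fst i g p) hg')

lemma diff_mulVec_comp_fst (i : Fin 4) (v : Fin (rank i) → ZMod 2) :
    (diff i).mulVec (fun p => v p.1) = 0 := by
  funext p
  simp [Matrix.mulVec, dotProduct, Fintype.sum_prod_type, ← Finset.sum_mul, sum_diff_eq_zero]

lemma functor_map_signIndMap_eq_zero (i : Fin 4) :
    (functor (ZMod 2) GG 0).map (signIndMap χ (cocycleShortComplex i).g) = 0 := by
  refine functor_map_zero_eq_zero _ fun F hF => ?_
  funext y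
  refine Subtype.ext ?_
  refine (congrArg (diff i).mulVec ?_).trans (diff_mulVec_comp_fst i fun c => F 0 (c, 1))
  exact funext (eq_of_mem_invariants i F (fun g y p => congrFun (congrFun (hF g) y) p) y)

lemma eq_of_mem_invariants_cocycle {i : Fin 4} {F : signInd χ (cocycle i)}
    (hF : ∀ g, (signInd χ (cocycle i)).ρ g F = F) (y : ZMod 2) (p : Basis i) :
    (F y).1 p = (F 0).1 (p.1, 1) :=
  eq_of_mem_invariants i (fun y => (F y).1)
    (fun g y p => congrFun (congrArg Subtype.val (congrFun (hF g) y)) p) y p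

lemma epi_map_signIndUnit_zero (i : Fin 4) :
    Epi ((functor (ZMod 2) GG 0).map (signIndUnit χ (cocycle i))) := by
  refine epi_functor_map_zero _ fun F hF => ?_
  have hF' (y : ZMod 2) : F y = F 0 := Subtype.ext <| funext fun p =>
    (eq_of_mem_invariants_cocycle hF y p).trans (eq_of_mem_invariants_cocycle hF 0 p).symm
  refine ⟨F 0, fun g => ?_, funext fun y => (hF' y).symm⟩
  exact (congrArg ((cocycle i).ρ g) (hF' _).symm).trans (congrFun (hF g) 0)

lemma finrank_signInd_cocycle_zero (i : Fin 4) :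
    Module.finrank (ZMod 2) (groupCohomology (signInd χ (cocycle i)) 0) = rank i := by
  refine (H0Iso _).toLinearEquiv.finrank_eq.trans ?_
  let e : (Fin (rank i) → ZMod 2) ≃ₗ[ZMod 2] (signInd χ (cocycle i)).ρ.invariants :=
    LinearEquiv.ofBijective
      { toFun v := ⟨fun _ => ⟨fun p => v p.1, diff_mulVec_comp_fst i v⟩, fun g => by
          refine funext fun y => Subtype.ext <| funext fun p => ?_
          exact congrArg v (gact_fst i g p)⟩
        map_add' _ _ := rfl
        map_smul' _ _ := rfl }
      ⟨fun v w h => funext fun c =>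
        congrFun (congrArg Subtype.val (congrFun (congrArg Subtype.val h) 0)) (c, 1), fun F =>
        ⟨fun c => (F.1 0).1 (c, 1), Subtype.ext <| funext fun y => Subtype.ext <| funext fun p =>
          (eq_of_mem_invariants_cocycle F.2 y p).symm⟩⟩
  exact e.finrank_eq.symm.trans (by simp)

lemma epi_map_signIndUnit (i : Fin 4) (n : ℕ) :
    Epi ((functor (ZMod 2) GG n).map (signIndUnit χ (cocycle i))) := by
  induction n generalizing i with
  | zero => exact epi_map_signIndUnit_zero i
  | succ n ih =>
    exact epi_map_signIndUnit_succ (shortExact_cocycleShortComplex i) (isZero_signInd_term i) n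
      (ih (i + 1))

lemma finrank_signInd_cocycle (i : Fin 4) (n : ℕ) :
    Module.finrank (ZMod 2) (groupCohomology (signInd χ (cocycle i)) n) =
      rank (i + Fin.ofNat 4 n) := by
  induction n generalizing i with
  | zero => exact (finrank_signInd_cocycle_zero i).trans (congrArg rank (add_zero i).symm)
  | succ n ih =>
    refine (finrank_signInd_succ (shortExact_cocycleShortComplex i) (isZero_signInd_term i)
      (functor_map_signIndMap_eq_zero i) n).trans ((ih (i + 1)).trans (congrArg rank ?_))
    ext
    simp [Fin.val_add]
    omega

lemma mem_support_three : ∀ c c' u, u ∈ support 3 c c' := by decide +kernel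

/-- The trivial representation is the first module of cocycles. -/
def trivialToCocycle : Rep.trivial (ZMod 2) GG (ZMod 2) ⟶ cocycle 0 :=
  Rep.ofHom
    { toFun v := ⟨fun _ => v, diff_mulVec_comp_fst 0 fun _ => v⟩
      map_add' _ _ := rfl
      map_smul' _ _ := rfl
      isIntertwining' _ := rfl }

lemma isIso_trivialToCocycle : IsIso trivialToCocycle := by
  have : Mono trivialToCocycle := (Rep.mono_iff_injective _).2 fun v w h =>
    congrFun (congrArg Subtype.val h) ((0 : Fin 1), 1)
  have : Epi trivialToCocycle := (Rep.epi_iff_surjective _).2 fun f => by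
    obtain ⟨f', hf'⟩ := exists_diff_mulVec_eq 3 f.1 f.2
    refine ⟨f.1 ((0 : Fin 1), 1), Subtype.ext (funext fun p => ?_)⟩
    change f.1 ((0 : Fin 1), 1) = f.1 p
    rw [← hf']
    exact congrArg (· ⬝ᵥ f') (funext fun q => 
      (if_pos (mem_support_three _ _ _)).trans (if_pos (mem_support_three _ _ _)).symm)
  exact isIso_of_mono_of_epi _

lemma finrank_trivial (n : ℕ) :
    Module.finrank (ZMod 2) (groupCohomology (Rep.trivial (ZMod 2) GG (ZMod 2)) n) =
      Module.finrank (ZMod 2) (groupCohomology (cocycle 0) n) := by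
  have := isIso_trivialToCocycle
  exact ((functor (ZMod 2) GG n).mapIso (asIso trivialToCocycle)).toLinearEquiv.finrank_eq

lemma finrank_trivial_zero :
    Module.finrank (ZMod 2) (groupCohomology (Rep.trivial (ZMod 2) GG (ZMod 2)) 0) = 1 :=
  (H0IsoOfIsTrivial _).toLinearEquiv.finrank_eq.trans (Module.finrank_self (ZMod 2))

lemma finrank_trivial_succ (n : ℕ) :
    Module.finrank (ZMod 2) (groupCohomology (Rep.trivial (ZMod 2) GG (ZMod 2)) (n + 1)) =
      Module.finrank (ZMod 2) (groupCohomology (Rep.trivial (ZMod 2) GG (ZMod 2)) n) +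
        rank (Fin.ofNat 4 (n + 1)) := by
  rw [finrank_trivial, finrank_trivial, finrank_succ_of_epi _ (epi_map_signIndUnit 0),
    finrank_signInd_cocycle, zero_add]

lemma ofNat_add (n m : ℕ) : Fin.ofNat 4 n + Fin.ofNat 4 m = Fin.ofNat 4 (n + m) := by
  ext
  simp [Fin.val_add]

/-- The periodicity of the increments turns the recursion into the asserted identity. -/
lemma mul_mk_of_periodic (h : ℕ → ℕ) (h0 : h 0 = 1)
    (hs : ∀ n, h (n + 1) = h n + rank (Fin.ofNat 4 (n + 1))) :
    ((1 - PowerSeries.X) ^ 2 * (1 + PowerSeries.X ^ 2) : PowerSeries ℤ) *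
      PowerSeries.mk (fun i => (h i : ℤ)) = 1 + PowerSeries.X + PowerSeries.X ^ 2 := by
  have h₁ : (1 - PowerSeries.X) * PowerSeries.mk (fun n => (h n : ℤ)) =
      PowerSeries.mk fun n => (rank (Fin.ofNat 4 n) : ℤ) := by
    ext n
    cases n with
    | zero => simp [h0, rank]
    | succ n => simp [sub_mul, PowerSeries.coeff_succ_X_mul, hs]
  have h₂ : (1 - PowerSeries.X + PowerSeries.X ^ 2 - PowerSeries.X ^ 3 : PowerSeries ℤ) *
      PowerSeries.mk (fun n => (rank (Fin.ofNat 4 n) : ℤ)) =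
        1 + PowerSeries.X + PowerSeries.X ^ 2 := by
    have hrank : ∀ i, (rank (i + 3) : ℤ) - rank (i + 2) + rank (i + 1) - rank i = 0 := by decide
    ext n
    match n with
    | 0 => simp [rank]
    | 1 =>
      simp [sub_mul, add_mul, PowerSeries.coeff_X_pow_mul', PowerSeries.coeff_X,
        PowerSeries.coeff_one, PowerSeries.coeff_succ_X_mul]
      rfl
    | 2 =>
      simp [sub_mul, add_mul, PowerSeries.coeff_X_pow_mul', PowerSeries.coeff_X,
        PowerSeries.coeff_X_pow, PowerSeries.coeff_one, PowerSeries.coeff_succ_X_mul]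
      rfl
    | n + 3 =>
      have hn := hrank (Fin.ofNat 4 n)
      rw [show (3 : Fin 4) = Fin.ofNat 4 3 from rfl, show (2 : Fin 4) = Fin.ofNat 4 2 from rfl,
        show (1 : Fin 4) = Fin.ofNat 4 1 from rfl, ofNat_add, ofNat_add, ofNat_add] at hn
      simp [sub_mul, add_mul, PowerSeries.coeff_X_pow_mul', PowerSeries.coeff_X,
        PowerSeries.coeff_X_pow, PowerSeries.coeff_one, PowerSeries.coeff_succ_X_mul]
      exact hn
  rw [← h₂, ← h₁]
  ring

end GG

/-- The Poincaré series of `H^*(G; 𝔽₂)` for `G = D₈ ∗ C₄` satisfies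
`(1 - t)² (1 + t²) · Σ hⁱ tⁱ = 1 + t + t²`, i.e. `Σ hⁱ tⁱ = (1 + t + t²)/((1 - t)²(1 + t²))`. -/
theorem poincare_series :
    ((1 - PowerSeries.X) ^ 2 * (1 + PowerSeries.X ^ 2) : PowerSeries ℤ) *
        PowerSeries.mk (fun i =>
          (Module.finrank (ZMod 2)
            (groupCohomology (Rep.trivial (ZMod 2) GG (ZMod 2)) i) : ℤ)) =
      1 + PowerSeries.X + PowerSeries.X ^ 2 := by
  exact GG.mul_mk_of_periodic _ GG.finrank_trivial_zero GG.finrank_trivial_succ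
end

section
/- In G = D₈ ∗ C₄ the following identities hold: γ = (σ · σρ)³ · ργ, (σρ · σ)³ · ργ = γ⁻¹, (ργ · σρ)³ · σ = γ⁻¹, and (σ · ργ)³ · σρ = γ⁻¹. Consequently, any automorphism of G that transposes two of the three generators ργ, σ, σρ and fixes the third sends γ to γ⁻¹, while any automorphism cyclically permuting these three generators fixes γ. -/
/-!
Let `D8 = ⟨σ, ρ⟩` be the dihedral group of order 8 (`ρ` of order 4, `σ` of order 2,
`σρσ⁻¹ = ρ⁻¹`) and `C4 = ⟨γ⟩` the cyclic group of order 4.  The central product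
`G = D8 ∗ C4` is the quotient of `D8 × C4` by the central subgroup generated by `ρ²γ⁻²`.
We model `D8` as `DihedralGroup 4` (with `ρ = r 1`, `σ = sr 0`) and `C4` as
`Multiplicative (ZMod 4)`.
-/

open DihedralGroup

/-- Two elements of `D8 × C4` that differ by a power of `zEl` have the same image in `G`. -/
theorem mk_eq_mk_of_eq_or_eq_mul_zEl {x y : D8 × C4} (h : y = x ∨ y = x * zEl) :
    (QuotientGroup.mk x : GG) = QuotientGroup.mk y := by
  rcases h with rfl | rfl
  · rfl
  · exact QuotientGroup.eq.mpr (by simp [Zc])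

theorem gamma_eq : γ' = (σ' * (σ' * ρ')) ^ 3 * (ρ' * γ') :=
  mk_eq_mk_of_eq_or_eq_mul_zEl (by decide)

theorem swap_one_two_gamma : ((σ' * ρ') * σ') ^ 3 * (ρ' * γ') = γ'⁻¹ :=
  mk_eq_mk_of_eq_or_eq_mul_zEl (by decide)

theorem swap_zero_one_gamma : ((ρ' * γ') * (σ' * ρ')) ^ 3 * σ' = γ'⁻¹ :=
  mk_eq_mk_of_eq_or_eq_mul_zEl (by decide)

theorem swap_zero_two_gamma : (σ' * (ρ' * γ')) ^ 3 * (σ' * ρ') = γ'⁻¹ :=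
  mk_eq_mk_of_eq_or_eq_mul_zEl (by decide)

theorem cycle_gamma : ((σ' * ρ') * (ρ' * γ')) ^ 3 * σ' = γ' :=
  mk_eq_mk_of_eq_or_eq_mul_zEl (by decide)

theorem cycle_inv_gamma : ((ρ' * γ') * σ') ^ 3 * (σ' * ρ') = γ' :=
  mk_eq_mk_of_eq_or_eq_mul_zEl (by decide)

theorem map_gamma {φ : GG ≃* GG} {π : Equiv.Perm (Fin 3)}
    (h : ∀ i : Fin 3, φ (gens i) = gens (π i)) :
    φ γ' = (gens (π 1) * gens (π 2)) ^ 3 * gens (π 0) := by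
  have hγ : γ' = (gens 1 * gens 2) ^ 3 * gens 0 := gamma_eq
  rw [hγ, map_mul, map_pow, map_mul, h, h, h]

theorem fin_three_of_sign_eq_neg_one : ∀ π : Equiv.Perm (Fin 3), Equiv.Perm.sign π = -1 →
    (π 0 = 0 ∧ π 1 = 2 ∧ π 2 = 1) ∨ (π 0 = 1 ∧ π 1 = 0 ∧ π 2 = 2) ∨
      (π 0 = 2 ∧ π 1 = 1 ∧ π 2 = 0) := by
  decide

theorem fin_three_of_sign_eq_one : ∀ π : Equiv.Perm (Fin 3), Equiv.Perm.sign π = 1 →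
    (π 0 = 0 ∧ π 1 = 1 ∧ π 2 = 2) ∨ (π 0 = 1 ∧ π 1 = 2 ∧ π 2 = 0) ∨
      (π 0 = 2 ∧ π 1 = 0 ∧ π 2 = 1) := by
  decide

/-- In `G = D₈ ∗ C₄`: `γ = (σ·σρ)³·ργ`, `(σρ·σ)³·ργ = γ⁻¹`, `(ργ·σρ)³·σ = γ⁻¹`, and
`(σ·ργ)³·σρ = γ⁻¹`.  Consequently any automorphism of `G` transposing two of the generators
`ργ, σ, σρ` and fixing the third sends `γ` to `γ⁻¹`, while any automorphism cyclically
permuting these three generators fixes `γ`. -/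
theorem gamma_identities_and_automorphisms :
    (γ' = (σ' * (σ' * ρ')) ^ 3 * (ρ' * γ') ∧
     ((σ' * ρ') * σ') ^ 3 * (ρ' * γ') = γ'⁻¹ ∧
     ((ρ' * γ') * (σ' * ρ')) ^ 3 * σ' = γ'⁻¹ ∧
     (σ' * (ρ' * γ')) ^ 3 * (σ' * ρ') = γ'⁻¹) ∧
    (∀ (φ : GG ≃* GG) (π : Equiv.Perm (Fin 3)), π.IsSwap →
      (∀ i : Fin 3, φ (gens i) = gens (π i)) → φ γ' = γ'⁻¹) ∧
    (∀ (φ : GG ≃* GG) (π : Equiv.Perm (Fin 3)), π.IsThreeCycle →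
      (∀ i : Fin 3, φ (gens i) = gens (π i)) → φ γ' = γ') := by
  refine ⟨⟨gamma_eq, swap_one_two_gamma, swap_zero_one_gamma, swap_zero_two_gamma⟩, ?_, ?_⟩
  · intro φ π hπ h
    rw [map_gamma h]
    rcases fin_three_of_sign_eq_neg_one π hπ.sign_eq with
      ⟨h0, h1, h2⟩ | ⟨h0, h1, h2⟩ | ⟨h0, h1, h2⟩ <;> rw [h0, h1, h2]
    · exact swap_one_two_gamma
    · exact swap_zero_one_gamma
    · exact swap_zero_two_gamma
  · intro φ π hπ h
    rw [map_gamma h]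
    rcases fin_three_of_sign_eq_one π hπ.sign with
      ⟨h0, h1, h2⟩ | ⟨h0, h1, h2⟩ | ⟨h0, h1, h2⟩ <;> rw [h0, h1, h2]
    · exact gamma_eq.symm
    · exact cycle_gamma
    · exact cycle_inv_gamma
end

section
/- There exists an automorphism of G = D₈ ∗ C₄ that interchanges σ and σρ and fixes ργ, and there exists an automorphism of G that interchanges σ and ργ and fixes σρ. -/
/-!
Let `D8 = ⟨σ, ρ⟩` be the dihedral group of order 8 (`ρ` of order 4, `σ` of order 2,
`σρσ⁻¹ = ρ⁻¹`) and `C4 = ⟨γ⟩` the cyclic group of order 4.  The central product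
`G = D8 ∗ C4` is the quotient of `D8 × C4` by the central subgroup generated by `ρ²γ⁻²`.
We model `D8` as `DihedralGroup 4` (with `ρ = r 1`, `σ = sr 0`) and `C4` as
`Multiplicative (ZMod 4)`.
-/

open DihedralGroup

theorem mk_eq_mk_of_mem_pair {x y : D8 × C4} (h : x⁻¹ * y = 1 ∨ x⁻¹ * y = zEl) :
    (QuotientGroup.mk x : GG) = QuotientGroup.mk y := by
  rw [QuotientGroup.eq]
  rcases h with h | h
  · rw [h]
    exact Zc.one_mem
  · rw [h]
    exact Subgroup.mem_zpowers zEl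

/-- A self-map of `D8 × C4` that is multiplicative and involutive up to the central element `zEl`,
and sends `zEl` into `{1, zEl}`, induces an automorphism of the central product. -/
theorem exists_mulEquiv_of_involutive_mod_center (F : D8 × C4 → D8 × C4)
    (hmul : ∀ x y, (F (x * y))⁻¹ * (F x * F y) = 1 ∨ (F (x * y))⁻¹ * (F x * F y) = zEl)
    (hz : (F zEl)⁻¹ * 1 = 1 ∨ (F zEl)⁻¹ * 1 = zEl)
    (hinv : ∀ x, (F (F x))⁻¹ * x = 1 ∨ (F (F x))⁻¹ * x = zEl) :
    ∃ φ : GG ≃* GG, ∀ x : D8 × C4, φ (QuotientGroup.mk x) = QuotientGroup.mk (F x) := by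
  let f : D8 × C4 →* GG :=
    MonoidHom.mk' (fun x => QuotientGroup.mk (F x)) fun x y => mk_eq_mk_of_mem_pair (hmul x y)
  have hker : Zc ≤ f.ker :=
    Subgroup.zpowers_le.mpr (MonoidHom.mem_ker.mpr (mk_eq_mk_of_mem_pair hz))
  let g : GG →* GG := QuotientGroup.lift Zc f hker
  have hg : g.comp g = MonoidHom.id GG :=
    QuotientGroup.monoidHom_ext Zc (MonoidHom.ext fun x => mk_eq_mk_of_mem_pair (hinv x))
  exact ⟨g.toMulEquiv g hg hg, fun x => rfl⟩

/-- The self-map of `D8 × C4` given by `σ ^ ε * ρ ^ i * c ↦ s ^ ε * t ^ i * c⁻¹`. -/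
def substGenerators (s t : D8 × C4) : D8 × C4 → D8 × C4
  | (r i, c) => t ^ i.val * (1, c⁻¹)
  | (sr i, c) => s * t ^ i.val * (1, c⁻¹)

/-- There is an automorphism of `G = D₈ ∗ C₄` interchanging `σ` and `σρ` and fixing `ργ`,
and one interchanging `σ` and `ργ` and fixing `σρ`. -/
theorem exists_transposition_automorphisms :
    (∃ φ : GG ≃* GG, φ σ' = σ' * ρ' ∧ φ (σ' * ρ') = σ' ∧ φ (ρ' * γ') = ρ' * γ') ∧
    (∃ φ : GG ≃* GG, φ σ' = ρ' * γ' ∧ φ (ρ' * γ') = σ' ∧ φ (σ' * ρ') = σ' * ρ') := by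
  constructor
  · obtain ⟨φ, hφ⟩ := exists_mulEquiv_of_involutive_mod_center
      (substGenerators (sr 1, 1) (r 3, 1)) (by decide +kernel) (by decide +kernel)
      (by decide +kernel)
    refine ⟨φ, ?_, ?_, ?_⟩
    all_goals
      simp only [σ', ρ', γ', ← QuotientGroup.mk_mul, hφ]
      exact mk_eq_mk_of_mem_pair (by decide +kernel)
  · obtain ⟨φ, hφ⟩ := exists_mulEquiv_of_involutive_mod_center
      (substGenerators (r 1, Multiplicative.ofAdd 1) (sr 0, Multiplicative.ofAdd 1))
      (by decide +kernel) (by decide +kernel) (by decide +kernel)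
    refine ⟨φ, ?_, ?_, ?_⟩
    all_goals
      simp only [σ', ρ', γ', ← QuotientGroup.mk_mul, hφ]
      exact mk_eq_mk_of_mem_pair (by decide +kernel)
end
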